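/- arXiv:1301.4623 — 5 statements merged into one kernel-verified Lean document; each statement's English description precedes it below -/
import Mathlib

section
/- Let n ≥ 5 and let M be a set of edges of the complete graph K_n with 0 ≤ |M| ≤ n − 3. Then the graph G obtained from K_n by deleting the edges of M contains two edge-disjoint spanning trees. -/
namespace SimpleGraph

variable {V : Type*}

/-- `G` contains two edge-disjoint connected spanning subgraphs. -/
def HasDisjointConnectedPair (G : SimpleGraph V) : Prop :=
  ∃ H₁ H₂ : SimpleGraph V, H₁ ≤ G ∧ H₂ ≤ G ∧ H₁.Connected ∧ H₂.Connected ∧ Disjoint H₁ H₂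

/-- Attaching a vertex by one edge to a connected graph on the remaining vertices gives a connected
graph. -/
theorem Connected.map_compl_singleton_sup_edge {v a : V} (hav : a ≠ v)
    {H : SimpleGraph ({v}ᶜ : Set V)} (hH : H.Connected) :
    (H.map (Function.Embedding.subtype _) ⊔ edge v a).Connected := by
  rw [connected_iff_exists_forall_reachable]
  have reachable_of_ne (w : V) (hw : w ≠ v) :
      (H.map (Function.Embedding.subtype _) ⊔ edge v a).Reachable a w :=
    ((hH.preconnected ⟨a, hav⟩ ⟨w, hw⟩).map (Embedding.map _ H).toHom).mono le_sup_left
  refine ⟨a, fun w ↦ ?_⟩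
  by_cases hw : w = v
  · subst hw
    exact Adj.reachable (Or.inr (by simp [edge_adj, hav]))
  · exact reachable_of_ne w hw

theorem HasDisjointConnectedPair.of_induce_compl_singleton {G : SimpleGraph V} {v a b : V}
    (hva : G.Adj v a) (hvb : G.Adj v b) (hab : a ≠ b)
    (h : (G.induce {v}ᶜ).HasDisjointConnectedPair) : G.HasDisjointConnectedPair := by
  obtain ⟨H₁, H₂, hle₁, hle₂, hc₁, hc₂, hd⟩ := h
  refine ⟨_, _, ?_, ?_, hc₁.map_compl_singleton_sup_edge hva.ne',
    hc₂.map_compl_singleton_sup_edge hvb.ne', ?_⟩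
  · exact sup_le (map_le_iff_le_comap _ _ _ |>.2 hle₁) (edge_le_iff _ |>.2 (Or.inr hva))
  · exact sup_le (map_le_iff_le_comap _ _ _ |>.2 hle₂) (edge_le_iff _ |>.2 (Or.inr hvb))
  · have hd' : ∀ x y, H₁.Adj x y → ¬ H₂.Adj x y := fun x y h₁ h₂ ↦
      (disjoint_left.1 hd x y h₁) h₂
    rw [disjoint_left]
    intro x y h₁ h₂
    simp only [sup_adj, map_adj, edge_adj, Function.Embedding.subtype_apply] at h₁ h₂
    have := hva.ne
    have := hvb.ne
    grind

theorem hasDisjointConnectedPair_top_of_card_eq_four [Fintype V] (hV : Fintype.card V = 4) :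
    (⊤ : SimpleGraph V).HasDisjointConnectedPair := by
  obtain ⟨e⟩ : Nonempty (V ≃ Fin 4) := ⟨Fintype.equivFinOfCardEq hV⟩
  let H₁ : SimpleGraph (Fin 4) := fromEdgeSet {s(0, 1), s(1, 2), s(2, 3)}
  let H₂ : SimpleGraph (Fin 4) := fromEdgeSet {s(1, 3), s(3, 0), s(0, 2)}
  have hc₁ : H₁.Connected := by
    rw [connected_iff_exists_forall_reachable]
    have h01 : H₁.Reachable 0 1 := Adj.reachable (by simp [H₁])
    have h12 : H₁.Reachable 1 2 := Adj.reachable (by simp [H₁])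
    have h23 : H₁.Reachable 2 3 := Adj.reachable (by simp [H₁])
    refine ⟨0, fun w ↦ ?_⟩
    fin_cases w
    exacts [.rfl, h01, h01.trans h12, (h01.trans h12).trans h23]
  have hc₂ : H₂.Connected := by
    rw [connected_iff_exists_forall_reachable]
    have h02 : H₂.Reachable 0 2 := Adj.reachable (by simp [H₂])
    have h03 : H₂.Reachable 0 3 := Adj.reachable (by simp [H₂])
    have h31 : H₂.Reachable 3 1 := Adj.reachable (by simp [H₂])
    refine ⟨0, fun w ↦ ?_⟩
    fin_cases w
    exacts [.rfl, h03.trans h31, h02, h03]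
  refine ⟨H₁.comap e, H₂.comap e, le_top, le_top, (Iso.comap e H₁).connected_iff.2 hc₁,
    (Iso.comap e H₂).connected_iff.2 hc₂, ?_⟩
  rw [disjoint_left]
  intro x y
  simp only [comap_adj, H₁, H₂]
  generalize e x = i
  generalize e y = j
  revert i j
  simp only [fromEdgeSet_adj, Set.mem_insert_iff, Set.mem_singleton_iff]
  decide

/-- The complete graph on five vertices `a, b, c, d, e` minus the edges `ab` and `cd` contains two
edge-disjoint Hamiltonian paths. -/
theorem hasDisjointConnectedPair_of_five {G : SimpleGraph V} {a b c d e : V}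
    (hV : ∀ x, x = a ∨ x = b ∨ x = c ∨ x = d ∨ x = e)
    (hdis : [a, b, c, d, e].Nodup)
    (hG : ∀ x y, x ≠ y → s(x, y) ≠ s(a, b) → s(x, y) ≠ s(c, d) → G.Adj x y) :
    G.HasDisjointConnectedPair := by
  have hne : (a ≠ b ∧ a ≠ c ∧ a ≠ d ∧ a ≠ e) ∧ (b ≠ c ∧ b ≠ d ∧ b ≠ e) ∧ (c ≠ d ∧ c ≠ e) ∧
    d ≠ e := by simpa [not_or] using hdis
  obtain ⟨⟨hab, hac, had, hae⟩, ⟨hbc, hbd, hbe⟩, ⟨hcd, hce⟩, hde⟩ := hne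
  let H₁ : SimpleGraph V := fromEdgeSet {s(c, a), s(a, e), s(e, b), s(b, d)}
  let H₂ : SimpleGraph V := fromEdgeSet {s(a, d), s(d, e), s(e, c), s(c, b)}
  refine ⟨H₁, H₂, ?_, ?_, ?_, ?_, ?_⟩
  · intro x y hxy
    simp only [H₁, fromEdgeSet_adj, Set.mem_insert_iff, Set.mem_singleton_iff, Sym2.eq_iff] at hxy
    apply hG x y hxy.2 <;> rw [Ne, Sym2.eq_iff] <;> clear hG hV hdis <;> grind
  · intro x y hxy
    simp only [H₂, fromEdgeSet_adj, Set.mem_insert_iff, Set.mem_singleton_iff, Sym2.eq_iff] at hxy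
    apply hG x y hxy.2 <;> rw [Ne, Sym2.eq_iff] <;> clear hG hV hdis <;> grind
  · rw [connected_iff_exists_forall_reachable]
    have hea : H₁.Reachable e a := Adj.reachable (by simp [H₁, hae.symm])
    have hac' : H₁.Reachable a c := Adj.reachable (by simp [H₁, hac])
    have heb : H₁.Reachable e b := Adj.reachable (by simp [H₁, hbe.symm])
    have hbd' : H₁.Reachable b d := Adj.reachable (by simp [H₁, hbd])
    refine ⟨e, fun w ↦ ?_⟩
    rcases hV w with rfl | rfl | rfl | rfl | rfl
    exacts [hea, heb, hea.trans hac', heb.trans hbd', .rfl]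
  · rw [connected_iff_exists_forall_reachable]
    have hed : H₂.Reachable e d := Adj.reachable (by simp [H₂, hde.symm])
    have hda : H₂.Reachable d a := Adj.reachable (by simp [H₂, had.symm])
    have hec : H₂.Reachable e c := Adj.reachable (by simp [H₂, hce.symm])
    have hcb : H₂.Reachable c b := Adj.reachable (by simp [H₂, hbc.symm])
    refine ⟨e, fun w ↦ ?_⟩
    rcases hV w with rfl | rfl | rfl | rfl | rfl
    exacts [hed.trans hda, hec.trans hcb, hec, hed, .rfl]
  · rw [disjoint_left]
    intro x y h₁ h₂
    simp only [H₁, H₂, fromEdgeSet_adj, Set.mem_insert_iff, Set.mem_singleton_iff,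
      Sym2.eq_iff] at h₁ h₂
    clear hG hV hdis
    grind

theorem compl_induce (G : SimpleGraph V) (s : Set V) : (G.induce s)ᶜ = Gᶜ.induce s := by
  ext x y
  simp [Subtype.ext_iff]

open scoped Classical in
theorem card_edgeFinset_compl_induce_compl_singleton [Fintype V] (G : SimpleGraph V) (v : V) :
    (G.induce {v}ᶜ)ᶜ.edgeFinset.card = Gᶜ.edgeFinset.card - Gᶜ.degree v := by
  rw [← card_edgeFinset_deleteIncidenceSet, ← card_edgeFinset_induce_compl_singleton]
  congr! 2
  exact compl_induce G _

open scoped Classical in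
theorem HasDisjointConnectedPair.of_induce_of_degree_compl [Fintype V] {G : SimpleGraph V} {v : V}
    (hv : Gᶜ.degree v + 3 ≤ Fintype.card V)
    (h : (G.induce {v}ᶜ).HasDisjointConnectedPair) : G.HasDisjointConnectedPair := by
  rw [degree_compl] at hv
  have hcard : 1 < (G.neighborFinset v).card := by
    rw [card_neighborFinset_eq_degree]
    have := G.degree_lt_card_verts v
    omega
  obtain ⟨a, ha, b, hb, hab⟩ := Finset.one_lt_card.1 hcard
  rw [mem_neighborFinset] at ha hb
  exact .of_induce_compl_singleton ha hb hab h

open scoped Classical in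
theorem hasDisjointConnectedPair_of_card_eq_five [Fintype V] {G : SimpleGraph V}
    (hV : Fintype.card V = 5) (hG : Gᶜ.edgeFinset.card ≤ 2) : G.HasDisjointConnectedPair := by
  by_cases hstar : ∃ v, Gᶜ.degree v = Gᶜ.edgeFinset.card
  · obtain ⟨v, hv⟩ := hstar
    refine .of_induce_of_degree_compl (v := v) (by omega) ?_
    have htop : G.induce {v}ᶜ = ⊤ := by
      have := card_edgeFinset_compl_induce_compl_singleton G v
      rw [hv, Nat.sub_self, Finset.card_eq_zero, edgeFinset_eq_empty] at this
      exact compl_eq_bot.1 this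
    rw [htop]
    apply hasDisjointConnectedPair_top_of_card_eq_four
    rw [Fintype.card_compl_set, hV]
    simp
  · push Not at hstar
    have hlt (v : V) : Gᶜ.degree v < Gᶜ.edgeFinset.card :=
      lt_of_le_of_ne (Gᶜ.degree_le_card_edgeFinset v) (hstar v)
    obtain ⟨a, b, hab⟩ : ∃ a b, Gᶜ.Adj a b := by
      by_contra! h
      have hbot : Gᶜ = ⊥ := by ext x y; simp [h]
      obtain ⟨v⟩ : Nonempty V := Fintype.card_pos_iff.1 (by omega)
      have := hlt v
      simp [hbot] at this
    have hdeg {x y z : V} (hy : Gᶜ.Adj x y) (hz : Gᶜ.Adj x z) : y = z := by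
      have : (Gᶜ.neighborFinset x).card ≤ 1 := by
        rw [card_neighborFinset_eq_degree]
        have := hlt x
        omega
      exact Finset.card_le_one.1 this y (by simpa using hy) z (by simpa using hz)
    have htwo : Gᶜ.edgeFinset.card = 2 := by
      have := hlt a
      have := (Gᶜ.degree_pos_iff_exists_adj a).2 ⟨b, hab⟩
      omega
    obtain ⟨f, hf, hfne⟩ := Finset.exists_mem_ne (by omega : 1 < Gᶜ.edgeFinset.card) s(a, b)
    induction f with | _ c d
    rw [mem_edgeFinset, mem_edgeSet] at hf
    have hedges : Gᶜ.edgeFinset = {s(a, b), s(c, d)} := by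
      symm
      apply Finset.eq_of_subset_of_card_le
      · intro x hx
        simp only [Finset.mem_insert, Finset.mem_singleton] at hx
        rcases hx with rfl | rfl
        · simpa using hab
        · simpa using hf
      · rw [htwo, Finset.card_pair hfne.symm]
    have hnd : [a, b, c, d].Nodup := by
      have := hab.ne
      have := hf.ne
      have := hab.symm
      have := hf.symm
      grind
    obtain ⟨e, he⟩ : ∃ e, e ∉ [a, b, c, d].toFinset := by
      by_contra! h
      have := Finset.card_le_card (fun x _ ↦ h x : Finset.univ ⊆ [a, b, c, d].toFinset)
      rw [Finset.card_univ, hV, List.toFinset_card_of_nodup hnd] at this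
      simp at this
    have hnd' : [a, b, c, d, e].Nodup := hnd.concat (mt List.mem_toFinset.2 he)
    have huniv : [a, b, c, d, e].toFinset = Finset.univ := by
      rw [← Finset.card_eq_iff_eq_univ, hV, List.toFinset_card_of_nodup hnd']
      simp
    refine hasDisjointConnectedPair_of_five (a := a) (b := b) (c := c) (d := d) (e := e)
      (fun x ↦ ?_) hnd' (fun x y hxy h₁ h₂ ↦ ?_)
    · have := Finset.mem_univ x
      rw [← huniv] at this
      simpa using this
    · by_contra h
      have : s(x, y) ∈ Gᶜ.edgeFinset := by simp [hxy, h]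
      rw [hedges, Finset.mem_insert, Finset.mem_singleton] at this
      exact this.elim h₁ h₂

open scoped Classical in
theorem hasDisjointConnectedPair_of_card_compl_le [Fintype V] {G : SimpleGraph V}
    (hV : 5 ≤ Fintype.card V) (hG : Gᶜ.edgeFinset.card ≤ Fintype.card V - 3) :
    G.HasDisjointConnectedPair := by
  obtain ⟨n, hn⟩ : ∃ n, n = Fintype.card V := ⟨_, rfl⟩
  rw [← hn] at hV hG
  induction n, hV using Nat.le_induction generalizing V with
  | base => exact hasDisjointConnectedPair_of_card_eq_five hn.symm hG
  | succ n hn5 ih =>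
    obtain ⟨v, hv⟩ : ∃ v, Gᶜ.edgeFinset.card - Gᶜ.degree v ≤ n - 3 := by
      by_cases h : ∃ a b, Gᶜ.Adj a b
      · obtain ⟨a, b, hab⟩ := h
        have := (Gᶜ.degree_pos_iff_exists_adj a).2 ⟨b, hab⟩
        exact ⟨a, by omega⟩
      · push Not at h
        have hbot : Gᶜ = ⊥ := by ext x y; simp [h]
        obtain ⟨v⟩ : Nonempty V := Fintype.card_pos_iff.1 (by omega)
        exact ⟨v, by simp [edgeFinset_eq_empty.2 hbot]⟩
    have := Gᶜ.degree_le_card_edgeFinset v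
    refine .of_induce_of_degree_compl (v := v) (by omega) (ih ?_ ?_)
    · rw [← card_edgeFinset_compl_induce_compl_singleton] at hv
      convert hv
    · rw [Fintype.card_compl_set, ← hn]
      simp

theorem HasDisjointConnectedPair.exists_isTree [Finite V] {G : SimpleGraph V}
    (h : G.HasDisjointConnectedPair) :
    ∃ T₁ T₂ : G.Subgraph, T₁.IsSpanning ∧ T₁.coe.IsTree ∧ T₂.IsSpanning ∧ T₂.coe.IsTree ∧
      Disjoint T₁.edgeSet T₂.edgeSet := by
  obtain ⟨H₁, H₂, hle₁, hle₂, hc₁, hc₂, hd⟩ := h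
  obtain ⟨F₁, hF₁, ht₁⟩ := hc₁.exists_isTree_le
  obtain ⟨F₂, hF₂, ht₂⟩ := hc₂.exists_isTree_le
  have hs₁ := toSubgraph.isSpanning F₁ (hF₁.trans hle₁)
  have hs₂ := toSubgraph.isSpanning F₂ (hF₂.trans hle₂)
  refine ⟨_, _, hs₁, ?_, hs₂, ?_, ?_⟩
  · exact (Subgraph.spanningCoeEquivCoeOfSpanning _ hs₁).isTree_iff.1 ht₁
  · exact (Subgraph.spanningCoeEquivCoeOfSpanning _ hs₂).isTree_iff.1 ht₂
  · exact disjoint_edgeSet.2 (hd.mono hF₁ hF₂)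

end SimpleGraph

/-- For `n ≥ 5` and a set `M` of at most `n - 3` edges of the complete graph
`K_n`, the graph obtained from `K_n` by deleting `M` contains two edge-disjoint
spanning trees. -/
theorem stmt_0 (n : ℕ) (hn : 5 ≤ n) (M : Finset (Sym2 (Fin n)))
    (hM : ↑M ⊆ (⊤ : SimpleGraph (Fin n)).edgeSet) (hMcard : M.card ≤ n - 3) :
    ∃ T₁ T₂ : ((⊤ : SimpleGraph (Fin n)).deleteEdges ↑M).Subgraph,
      T₁.IsSpanning ∧ T₁.coe.IsTree ∧ T₂.IsSpanning ∧ T₂.coe.IsTree ∧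
      Disjoint T₁.edgeSet T₂.edgeSet := by
  classical
  apply SimpleGraph.HasDisjointConnectedPair.exists_isTree
  apply SimpleGraph.hasDisjointConnectedPair_of_card_compl_le
  · simpa using hn
  · rw [Fintype.card_fin]
    refine (Finset.card_le_card fun e he ↦ ?_).trans hMcard
    induction e with | _ x y
    simp only [SimpleGraph.mem_edgeFinset, SimpleGraph.mem_edgeSet, SimpleGraph.compl_adj,
      SimpleGraph.deleteEdges_adj, SimpleGraph.top_adj, Finset.mem_coe] at he
    tauto
end

section
/- Let G be a connected graph with 5 vertices and at least 6 edges. Then κ̄₃(G) ≥ 2. -/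
open SimpleGraph

/-- An `S`-Steiner tree in `G`: a subgraph that is a tree and contains `S`. -/
def SimpleGraph.IsSteinerTree {V : Type*} (G : SimpleGraph V) (S : Set V)
    (T : G.Subgraph) : Prop :=
  S ⊆ T.verts ∧ T.coe.IsTree

/-- `κ(S)`: the maximum number of pairwise internally disjoint `S`-Steiner trees in `G`. -/
noncomputable def SimpleGraph.steinerConn {V : Type*} (G : SimpleGraph V) (S : Set V) : ℕ :=
  sSup {n : ℕ | ∃ f : Fin n → G.Subgraph,
    (∀ i, G.IsSteinerTree S (f i)) ∧
    ∀ i j, i ≠ j →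
      (f i).edgeSet ∩ (f j).edgeSet = ∅ ∧ (f i).verts ∩ (f j).verts = S}

/-- `κ̄ₖ(G) = max {κ(S) : S ⊆ V(G), |S| = k}`, the maximal generalized local connectivity. -/
noncomputable def SimpleGraph.kappaBar {V : Type*} (G : SimpleGraph V) (k : ℕ) : ℕ :=
  sSup {m : ℕ | ∃ S : Finset V, S.card = k ∧ G.steinerConn ↑S = m}

/-- `p` is an ear of the cycle `c` in `G`: a nontrivial path (whose two endpoints may
coincide) meeting `c` exactly in its endpoints. -/
def SimpleGraph.IsEar {V : Type*} (G : SimpleGraph V) {x u v : V}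
    (c : G.Walk x x) (p : G.Walk u v) : Prop :=
  0 < p.length ∧ u ∈ c.support ∧ v ∈ c.support ∧
  p.support.tail.Nodup ∧ (u = v ∨ u ∉ p.support.tail) ∧
  ∀ w ∈ p.support, w ∈ c.support → w = u ∨ w = v

namespace SimpleGraph

variable {V : Type*} {G : SimpleGraph V}

/-- The subgraph traced out by a path is a tree. -/
theorem Walk.IsPath.isTree_coe_toSubgraph {u v : V} {p : G.Walk u v} (hp : p.IsPath) :
    p.toSubgraph.coe.IsTree := by
  classical
  have hverts : p.toSubgraph.verts = (p.support.toFinset : Set V) := by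
    ext w
    simp
  have hedges : p.toSubgraph.edgeSet = (p.edges.toFinset : Set (Sym2 V)) := by
    ext e
    simp
  have : Finite p.toSubgraph.verts := by
    rw [hverts]
    exact Finset.finite_toSet _
  refine isTree_iff_connected_and_card.2 ⟨p.toSubgraph_connected.coe, ?_⟩
  rw [Nat.card_coe_set_eq, Nat.card_coe_set_eq,
    ← Set.ncard_image_of_injective _ (Sym2.map.injective Subtype.val_injective),
    Subgraph.image_coe_edgeSet_coe, hedges, hverts, Set.ncard_coe_finset, Set.ncard_coe_finset,
    List.toFinset_card_of_nodup hp.isTrail.edges_nodup,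
    List.toFinset_card_of_nodup hp.support_nodup, Walk.length_edges, Walk.length_support]

/-- A Steiner tree for a nontrivial set of terminals has an edge. -/
theorem IsSteinerTree.edgeSet_nonempty {S : Set V} {T : G.Subgraph} (hT : G.IsSteinerTree S T)
    (hS : S.Nontrivial) : T.edgeSet.Nonempty := by
  obtain ⟨x, hx, y, hy, hxy⟩ := hS
  have : Nontrivial T.verts := ⟨⟨x, hT.1 hx⟩, ⟨y, hT.1 hy⟩, fun h ↦ hxy (congrArg Subtype.val h)⟩
  obtain ⟨w, hw⟩ := hT.2.connected.preconnected.exists_adj_of_nontrivial ⟨x, hT.1 hx⟩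
  exact ⟨s(x, w), hw⟩

theorem le_steinerConn [Finite V] {S : Set V} (hS : S.Nontrivial) {n : ℕ}
    (f : Fin n → G.Subgraph) (hf : ∀ i, G.IsSteinerTree S (f i))
    (hdisj : ∀ i j, i ≠ j →
      (f i).edgeSet ∩ (f j).edgeSet = ∅ ∧ (f i).verts ∩ (f j).verts = S) :
    n ≤ G.steinerConn S := by
  refine le_csSup ⟨Nat.card G.Subgraph, ?_⟩ ⟨f, hf, hdisj⟩
  rintro m ⟨g, hg, hgd⟩
  have hinj : Function.Injective g := by
    intro i j hij
    by_contra hne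
    have h := (hgd i j hne).1
    rw [hij, Set.inter_self] at h
    exact ((hg j).edgeSet_nonempty hS).ne_empty h
  simpa using Nat.card_le_card_of_injective g hinj

theorem steinerConn_le_kappaBar [Finite V] (S : Finset V) :
    G.steinerConn S ≤ G.kappaBar S.card :=
  le_csSup ((Set.finite_range fun T : Finset V ↦ G.steinerConn T).subset
    (by rintro _ ⟨T, _, hT⟩; exact ⟨T, hT⟩)).bddAbove ⟨S, rfl, rfl⟩

/-- Two edge-disjoint paths sharing exactly three vertices witness `κ̄₃(G) ≥ 2`. -/
theorem two_le_kappaBar_three_of_isPath [Finite V] {u v x y a b c : V} {p : G.Walk u v}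
    {q : G.Walk x y} (hp : p.IsPath) (hq : q.IsPath) (hab : a ≠ b) (hac : a ≠ c) (hbc : b ≠ c)
    (hS : ∀ w, w ∈ p.support ∧ w ∈ q.support ↔ w = a ∨ w = b ∨ w = c)
    (hE : p.edges.Disjoint q.edges) : 2 ≤ G.kappaBar 3 := by
  classical
  have hinter : p.toSubgraph.verts ∩ q.toSubgraph.verts = (({a, b, c} : Finset V) : Set V) := by
    ext w
    simpa using hS w
  have hedge : p.toSubgraph.edgeSet ∩ q.toSubgraph.edgeSet = ∅ := by
    ext e
    simpa using fun h h' ↦ hE h h'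
  have hcard : ({a, b, c} : Finset V).card = 3 :=
    Finset.card_eq_three.2 ⟨a, b, c, hab, hac, hbc, rfl⟩
  rw [← hcard]
  refine le_trans (le_steinerConn ⟨a, by simp, b, by simp, hab⟩
    ![p.toSubgraph, q.toSubgraph] ?_ ?_) (steinerConn_le_kappaBar _)
  · rw [Fin.forall_fin_two]
    exact ⟨⟨hinter ▸ Set.inter_subset_left, hp.isTree_coe_toSubgraph⟩,
      ⟨hinter ▸ Set.inter_subset_right, hq.isTree_coe_toSubgraph⟩⟩
  · intro i j hij
    fin_cases i <;> fin_cases j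
    · exact absurd rfl hij
    · exact ⟨hedge, hinter⟩
    · exact ⟨Set.inter_comm _ _ ▸ hedge, Set.inter_comm _ _ ▸ hinter⟩
    · exact absurd rfl hij

section Patterns

variable [Finite V] {a b c d e : V}

/-- Two triangles `abc` and `abd` sharing the edge `ab`. -/
theorem two_le_kappaBar_three_of_diamond (hnd : [a, b, c, d].Nodup) (hab : G.Adj a b)
    (hac : G.Adj a c) (hbc : G.Adj b c) (had : G.Adj a d) (hbd : G.Adj b d) :
    2 ≤ G.kappaBar 3 := by
  refine two_le_kappaBar_three_of_isPath (a := a) (b := b) (c := c)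
    (p := .cons hac.symm (.cons hab .nil))
    (q := .cons hbc.symm (.cons hbd (.cons had.symm .nil))) ?_ ?_ ?_ ?_ ?_ ?_ ?_ <;>
  simp [List.disjoint_left, Walk.cons_isPath_iff] at hnd ⊢ <;> grind

/-- A triangle `abc` and a 4-cycle `abed` sharing the edge `ab`. -/
theorem two_le_kappaBar_three_of_house (hnd : [a, b, c, d, e].Nodup) (hab : G.Adj a b)
    (hac : G.Adj a c) (hbc : G.Adj b c) (had : G.Adj a d) (hde : G.Adj d e) (hbe : G.Adj b e) :
    2 ≤ G.kappaBar 3 := by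
  refine two_le_kappaBar_three_of_isPath (a := a) (b := b) (c := c)
    (p := .cons hac.symm (.cons hab .nil))
    (q := .cons hbc.symm (.cons hbe (.cons hde.symm (.cons had.symm .nil))))
    ?_ ?_ ?_ ?_ ?_ ?_ ?_ <;>
  simp [List.disjoint_left, Walk.cons_isPath_iff] at hnd ⊢ <;> grind

/-- The complete bipartite graph with parts `{a, b}` and `{c, d, e}`. -/
theorem two_le_kappaBar_three_of_completeBipartite (hnd : [a, b, c, d, e].Nodup)
    (hac : G.Adj a c) (had : G.Adj a d) (hae : G.Adj a e)
    (hbc : G.Adj b c) (hbd : G.Adj b d) (hbe : G.Adj b e) :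
    2 ≤ G.kappaBar 3 := by
  refine two_le_kappaBar_three_of_isPath (a := a) (b := b) (c := c)
    (p := .cons hac.symm (.cons had (.cons hbd.symm .nil)))
    (q := .cons hbc.symm (.cons hbe (.cons hae.symm .nil))) ?_ ?_ ?_ ?_ ?_ ?_ ?_ <;>
  simp [List.disjoint_left, Walk.cons_isPath_iff] at hnd ⊢ <;> grind

/-- Two triangles `abc` and `ade` sharing the vertex `a`. -/
theorem two_le_kappaBar_three_of_butterfly (hnd : [a, b, c, d, e].Nodup)
    (hab : G.Adj a b) (hac : G.Adj a c) (hbc : G.Adj b c)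
    (had : G.Adj a d) (hae : G.Adj a e) (hde : G.Adj d e) :
    2 ≤ G.kappaBar 3 := by
  refine two_le_kappaBar_three_of_isPath (a := a) (b := b) (c := d)
    (p := .cons hab.symm (.cons had .nil))
    (q := .cons hbc (.cons hac.symm (.cons hae (.cons hde.symm .nil)))) ?_ ?_ ?_ ?_ ?_ ?_ ?_ <;>
  simp [List.disjoint_left, Walk.cons_isPath_iff] at hnd ⊢ <;> grind

end Patterns

end SimpleGraph

/-- A connected graph with 5 vertices and at least 6 edges has `κ̄₃(G) ≥ 2`. -/
theorem stmt_2 {V : Type*} [Fintype V] (G : SimpleGraph V) (hG : G.Connected)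
    (hcard : Fintype.card V = 5) (he : 6 ≤ G.edgeSet.ncard) :
    2 ≤ G.kappaBar 3 := by
  classical
  have hsum := G.sum_degrees_eq_twice_card_edges
  rw [← Set.ncard_coe_finset, SimpleGraph.coe_edgeFinset] at hsum
  obtain ⟨v, hv⟩ : ∃ v, 3 ≤ G.degree v := by
    by_contra! h
    have : ∑ v, G.degree v ≤ ∑ _v : V, 2 := Finset.sum_le_sum fun v _ ↦ by have := h v; omega
    simp only [Finset.sum_const, Finset.card_univ, hcard, smul_eq_mul] at this
    omega
  obtain ⟨N, hN, hN3⟩ := Finset.exists_subset_card_eq hv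
  obtain ⟨a, b, c, hab, hac, hbc, rfl⟩ := Finset.card_eq_three.1 hN3
  have hva : G.Adj v a := by simpa using hN (by simp : a ∈ _)
  have hvb : G.Adj v b := by simpa using hN (by simp : b ∈ _)
  have hvc : G.Adj v c := by simpa using hN (by simp : c ∈ _)
  have h4 : ({v, a, b, c} : Finset V).card = 4 := by
    simp [hva.ne, hvb.ne, hvc.ne, hab, hac, hbc]
  obtain ⟨w, hw⟩ : ∃ w, w ∉ ({v, a, b, c} : Finset V) := by
    by_contra! h
    have := Finset.card_le_card (fun x _ ↦ h x : Finset.univ ⊆ _)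
    simp only [Finset.card_univ] at this
    omega
  have huniv : (Finset.univ : Finset V) = insert w {v, a, b, c} :=
    (Finset.eq_univ_of_card _ (by rw [Finset.card_insert_of_notMem hw, h4, hcard])).symm
  have hnd : [w, v, a, b, c].Nodup := by
    simp at hw ⊢
    grind [hva.ne, hvb.ne, hvc.ne]
  have hthree : 3 ≤ (if G.Adj v w then 1 else 0) + (if G.Adj a b then 1 else 0) +
      (if G.Adj a c then 1 else 0) + (if G.Adj b c then 1 else 0) +
      (if G.Adj w a then 1 else 0) + (if G.Adj w b then 1 else 0) +
      (if G.Adj w c then 1 else 0) := by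
    have hdeg (x : V) : G.degree x = ∑ y, if G.Adj x y then 1 else 0 := by
      rw [← G.card_neighborFinset_eq_degree, neighborFinset_eq_filter, Finset.card_filter]
    simp only [List.nodup_cons, List.mem_cons, not_or, List.not_mem_nil, not_false_eq_true,
      and_true] at hnd
    simp only [hdeg, huniv, Finset.sum_insert, Finset.sum_singleton, Finset.mem_insert,
      Finset.mem_singleton, hnd, or_self, not_false_eq_true, SimpleGraph.irrefl, if_false,
      G.adj_comm w v, G.adj_comm a w, G.adj_comm b w, G.adj_comm c w, G.adj_comm b a,
      G.adj_comm c a, G.adj_comm c b, hva, hvb, hvc, hva.symm, hvb.symm, hvc.symm, if_true] at hsum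
    omega
  by_contra hk
  have hdiamond (p q r s : V) (h : [p, q, r, s].Nodup) (h₁ : G.Adj p q) (h₂ : G.Adj p r)
      (h₃ : G.Adj q r) (h₄ : G.Adj p s) : ¬ G.Adj q s :=
    fun h₅ ↦ hk (two_le_kappaBar_three_of_diamond h h₁ h₂ h₃ h₄ h₅)
  have hhouse (p q r : V) (h : [v, p, r, q, w].Nodup) (h₁ : G.Adj v p) (h₂ : G.Adj v q)
      (h₃ : G.Adj v r) (h₄ : G.Adj w p) (h₅ : G.Adj w q) : ¬ G.Adj p r :=
    fun h₆ ↦ hk (two_le_kappaBar_three_of_house h h₁ h₃ h₆ h₂ h₅.symm h₄.symm)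
  have hbip : G.Adj w a → G.Adj w b → ¬ G.Adj w c :=
    fun h₁ h₂ h₃ ↦ hk (two_le_kappaBar_three_of_completeBipartite hnd h₁ h₂ h₃ hva hvb hvc)
  have hbutterfly (p q r : V) (h : [v, w, p, q, r].Nodup) (h₀ : G.Adj v w) (h₁ : G.Adj v p)
      (h₂ : G.Adj v q) (h₃ : G.Adj v r) (h₄ : G.Adj w p) : ¬ G.Adj q r :=
    fun h₅ ↦ hk (two_le_kappaBar_three_of_butterfly h h₀ h₁ h₄ h₂ h₃ h₅)
  clear hk hsum he hN hN3 hv hw huniv h4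
  simp at hnd hdiamond hhouse hbutterfly
  grind [SimpleGraph.Adj.symm]
end

section
/- Let n = 3r + q with r ≥ 1 and 0 ≤ q ≤ 2. Then f(n; κ̄₃ = 1) = (4n − 3 − q)/3; that is, the maximum number of edges of a connected graph G on n vertices with κ̄₃(G) = 1 equals (4n − 3 − q)/3, and in particular this maximum is attained by some such graph. -/
open SimpleGraph

namespace SimpleGraph

variable {V : Type*} {G : SimpleGraph V}

/-- Every connected subgraph has a spanning tree. -/
theorem Subgraph.Connected.exists_isTree {K : G.Subgraph} (hK : K.Connected) :
    ∃ T : G.Subgraph, T ≤ K ∧ T.verts = K.verts ∧ T.coe.IsTree := by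
  obtain ⟨F, hF, hT⟩ := hK.coe.exists_isTree_le
  let T : G.Subgraph :=
    { verts := K.verts
      Adj := fun u v => ∃ (hu : u ∈ K.verts) (hv : v ∈ K.verts), F.Adj ⟨u, hu⟩ ⟨v, hv⟩
      adj_sub := fun ⟨_, _, h⟩ => K.adj_sub (hF h)
      edge_vert := fun ⟨hu, _, _⟩ => hu
      symm := ⟨fun _ _ ⟨hu, hv, h⟩ => ⟨hv, hu, h.symm⟩⟩ }
  have hco : T.coe = F := by
    ext u v
    exact ⟨fun ⟨_, _, h⟩ => h, fun h => ⟨u.2, v.2, h⟩⟩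
  exact ⟨T, ⟨subset_rfl, fun _ _ ⟨_, _, h⟩ => hF h⟩, rfl, hco ▸ hT⟩

/-- A Steiner tree has an edge across every cut that separates `S`. -/
theorem IsSteinerTree.exists_adj_crossing {S : Set V} {T : G.Subgraph}
    (hT : G.IsSteinerTree S T) (A : V → Prop) {s t : V} (hs : s ∈ S) (ht : t ∈ S)
    (hsA : A s) (htA : ¬ A t) : ∃ u v, T.Adj u v ∧ A u ∧ ¬ A v := by
  obtain ⟨p⟩ := hT.2.connected.preconnected ⟨s, hT.1 hs⟩ ⟨t, hT.1 ht⟩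
  obtain ⟨d, -, h₁, h₂⟩ := p.exists_boundary_dart {x | A x.1} hsA htA
  exact ⟨_, _, d.adj, h₁, h₂⟩

theorem bddAbove_steinerConn [Finite V] {S : Set V} (hS : S.Nontrivial) :
    BddAbove {n : ℕ | ∃ f : Fin n → G.Subgraph,
      (∀ i, G.IsSteinerTree S (f i)) ∧
      ∀ i j, i ≠ j →
        (f i).edgeSet ∩ (f j).edgeSet = ∅ ∧ (f i).verts ∩ (f j).verts = S} := by
  refine ⟨Nat.card (Sym2 V), ?_⟩
  rintro n ⟨f, hf, hd⟩
  obtain ⟨s, hs, t, ht, hst⟩ := hS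
  have h : ∀ i, ∃ e, e ∈ (f i).edgeSet := fun i => by
    obtain ⟨u, v, huv, -⟩ := (hf i).exists_adj_crossing (· = s) hs ht rfl hst.symm
    exact ⟨s(u, v), huv⟩
  choose e he using h
  have hinj : Function.Injective e := fun i j hij => by
    by_contra hne
    have : e i ∈ (f i).edgeSet ∩ (f j).edgeSet := ⟨he i, hij ▸ he j⟩
    rw [(hd i j hne).1] at this
    exact this
  simpa using Nat.card_le_card_of_injective e hinj

theorem le_kappaBar [Finite V] (k : ℕ) (S : Finset V) (hS : S.card = k) :
    G.steinerConn (S : Set V) ≤ G.kappaBar k := by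
  refine le_csSup (Set.Finite.bddAbove ?_) ⟨S, hS, rfl⟩
  have := Fintype.ofFinite V
  refine (Set.finite_range fun S : Finset V => G.steinerConn (S : Set V)).subset ?_
  rintro m ⟨S, -, rfl⟩
  exact ⟨S, rfl⟩

theorem one_le_steinerConn [Finite V] (hG : G.Connected) {S : Set V} (hS : S.Nontrivial) :
    1 ≤ G.steinerConn S := by
  obtain ⟨T, -, hv, hT⟩ := (Subgraph.connected_iff_forall_exists_walk_subgraph (⊤ : G.Subgraph)).2
    ⟨⟨hS.nonempty.some, trivial⟩, fun {u v} _ _ => by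
      obtain ⟨p⟩ := hG.preconnected u v
      exact ⟨p, le_top⟩⟩ |>.exists_isTree
  refine le_csSup (bddAbove_steinerConn hS) ⟨fun _ => T, fun _ => ⟨by simp [hv], hT⟩, ?_⟩
  intro i j hij
  exact absurd (Subsingleton.elim i j) hij

/-- If a connected graph stays connected without the two edges `xy` and `xz`, then the path
`y x z` and a spanning tree of the rest are two internally disjoint Steiner trees. -/
theorem two_le_kappaBar_of_connected_deleteEdges [Finite V] {x y z : V} (hxy : G.Adj x y)
    (hxz : G.Adj x z) (hyz : y ≠ z) (h : (G.deleteEdges {s(x, y), s(x, z)}).Connected) :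
    2 ≤ G.kappaBar 3 := by
  classical
  set H := G.deleteEdges {s(x, y), s(x, z)} with hH
  obtain ⟨T₁, hle₁, hv₁, hT₁⟩ := (Subgraph.connected_sup
    (Subgraph.subgraphOfAdj_connected hxy).preconnected
    (Subgraph.subgraphOfAdj_connected hxz).preconnected ⟨x, by simp⟩).exists_isTree
  obtain ⟨F, hF, hFT⟩ := h.exists_isTree_le
  obtain ⟨T₂, hle₂, hv₂, hT₂⟩ :=
    (Subgraph.Connected.exists_isTree (K := toSubgraph H (G.deleteEdges_le _)) (by
      rw [Subgraph.connected_iff']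
      have : (toSubgraph H (G.deleteEdges_le _)).IsSpanning := toSubgraph.isSpanning _ _
      exact ((toSubgraph H (G.deleteEdges_le _)).spanningCoeEquivCoeOfSpanning
        this).connected_iff.1 h))
  have hS : ({x, y, z} : Finset V).card = 3 :=
    Finset.card_eq_three.2 ⟨x, y, z, hxy.ne, hxz.ne, hyz, rfl⟩
  refine le_trans ?_ (le_kappaBar 3 {x, y, z} hS)
  have hv₁' : T₁.verts = (({x, y, z} : Finset V) : Set V) := by
    rw [hv₁]; ext v; simp; tauto
  have hv₂' : T₂.verts = Set.univ := by rw [hv₂]; rfl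
  have hd : T₁.edgeSet ∩ T₂.edgeSet = ∅ := by
    ext e
    simp only [Set.mem_inter_iff, Set.mem_empty_iff_false, iff_false]
    rintro ⟨h₁, h₂⟩
    have h₁ := Subgraph.edgeSet_mono hle₁ h₁
    have h₂ := Subgraph.edgeSet_mono hle₂ h₂
    induction e with | _ u v =>
    have h₂ : H.Adj u v := h₂
    rw [hH, deleteEdges_adj] at h₂
    apply h₂.2
    simpa [eq_comm, or_comm] using h₁
  refine le_csSup (bddAbove_steinerConn ⟨x, by simp, y, by simp, hxy.ne⟩)
    ⟨![T₁, T₂], ?_, ?_⟩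
  · intro i
    fin_cases i
    · exact ⟨hv₁'.ge, hT₁⟩
    · exact ⟨by simp [hv₂'], hT₂⟩
  · intro i j hij
    fin_cases i <;> fin_cases j <;> first | exact absurd rfl hij | skip
    · exact ⟨hd, by simp [hv₁', hv₂']⟩
    · exact ⟨by rw [Set.inter_comm]; exact hd, by simp [hv₁', hv₂']⟩

theorem kappaBar_three_eq_one [Finite V] (hG : G.Connected) (hV : 3 ≤ Nat.card V)
    (h : ∀ S : Finset V, S.card = 3 → ∀ T₁ T₂ : G.Subgraph,
      G.IsSteinerTree S T₁ → G.IsSteinerTree S T₂ → ¬ Disjoint T₁.edgeSet T₂.edgeSet) :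
    G.kappaBar 3 = 1 := by
  have := Fintype.ofFinite V
  have hnt : ∀ S : Finset V, S.card = 3 → (S : Set V).Nontrivial := fun S hS => by
    rw [Finset.nontrivial_coe, ← Finset.one_lt_card_iff_nontrivial]; omega
  rw [Nat.card_eq_fintype_card] at hV
  obtain ⟨S, -, hS⟩ := Finset.exists_subset_card_eq (s := (Finset.univ : Finset V)) hV
  refine le_antisymm (csSup_le ⟨_, S, hS, rfl⟩ ?_)
    ((one_le_steinerConn hG (hnt S hS)).trans (le_kappaBar 3 S hS))
  rintro m ⟨S, hS, rfl⟩
  refine csSup_le ⟨0, Fin.elim0, fun i => i.elim0, fun i => i.elim0⟩ ?_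
  rintro m ⟨f, hf, hd⟩
  by_contra! hm
  refine h S hS _ _ (hf ⟨0, by omega⟩) (hf ⟨1, hm⟩) ?_
  exact Set.disjoint_iff_inter_eq_empty.2 (hd _ _ (by simp)).1

/-- Two edges `e` and `f` are coparallel if they are equal or form an edge cut of `G`: some
2-colouring of the vertices is bichromatic exactly on the symmetric difference of `{e}`, `{f}`. -/
def Coparallel (G : SimpleGraph V) (e f : Sym2 V) : Prop :=
  ∃ A : V → Prop, ∀ u v, G.Adj u v → (Xor (A u) (A v) ↔ Xor (s(u, v) = e) (s(u, v) = f))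

theorem Coparallel.refl (e : Sym2 V) : G.Coparallel e e :=
  ⟨fun _ => True, by simp [Xor]⟩

theorem Coparallel.symm {e f : Sym2 V} (h : G.Coparallel e f) : G.Coparallel f e := by
  obtain ⟨A, hA⟩ := h
  exact ⟨A, fun u v huv => by rw [hA u v huv, xor_comm]⟩

theorem Coparallel.trans {e f g : Sym2 V} (h₁ : G.Coparallel e f) (h₂ : G.Coparallel f g) :
    G.Coparallel e g := by
  obtain ⟨A, hA⟩ := h₁
  obtain ⟨B, hB⟩ := h₂
  refine ⟨fun v => Xor (A v) (B v), fun u v huv => ?_⟩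
  have := hA u v huv
  have := hB u v huv
  grind

/-- Distinct edges outside a connected spanning subgraph are not coparallel. -/
theorem not_coparallel_of_notMem {T : SimpleGraph V} (hTG : T ≤ G) (hT : T.Connected)
    {e f : Sym2 V} (he : e ∈ G.edgeSet) (heT : e ∉ T.edgeSet) (hfT : f ∉ T.edgeSet)
    (hef : e ≠ f) : ¬ G.Coparallel e f := by
  rintro ⟨A, hA⟩
  induction e with | _ x y =>
  have hx : Xor (A x) (A y) := (hA x y he).2 (Or.inl ⟨rfl, hef⟩)
  have hcut : ∀ u v, A u → ¬ A v → False := fun u v hu hv => by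
    obtain ⟨p⟩ := hT.preconnected u v
    obtain ⟨d, -, h₁, h₂⟩ := p.exists_boundary_dart {w | A w} hu hv
    rcases (hA _ _ (hTG d.adj)).1 (Or.inl ⟨h₁, h₂⟩) with h | h
    · exact heT (h.1 ▸ d.adj)
    · exact hfT (h.1 ▸ d.adj)
  rcases hx with h | h
  · exact hcut _ _ h.1 h.2
  · exact hcut _ _ h.1 h.2

theorem coparallel_of_not_connected {e f : Sym2 V} (he : (G.deleteEdges {e}).Connected)
    (hf : (G.deleteEdges {f}).Connected) (h : ¬ (G.deleteEdges {e, f}).Connected) :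
    G.Coparallel e f := by
  have := he.nonempty
  have hpre : ¬ (G.deleteEdges {e, f}).Preconnected := fun hp => h ⟨hp⟩
  simp only [Preconnected, not_forall] at hpre
  obtain ⟨a, b, hab⟩ := hpre
  set A : V → Prop := (G.deleteEdges {e, f}).Reachable a
  have hcross : ∀ u v, G.Adj u v → A u → ¬ A v → s(u, v) = e ∨ s(u, v) = f := by
    intro u v huv hu hv
    by_contra hne
    exact hv (hu.trans (Adj.reachable (by simpa [huv] using hne)))
  have key : ∀ g g' : Sym2 V, (∀ u v, G.Adj u v → A u → ¬ A v → s(u, v) = g ∨ s(u, v) = g') →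
      (G.deleteEdges {g}).Connected → ∃ u v, s(u, v) = g' ∧ A u ∧ ¬ A v := by
    intro g g' hgg hg
    obtain ⟨p⟩ := hg.preconnected a b
    obtain ⟨d, -, h₁, h₂⟩ := p.exists_boundary_dart {w | A w} (Reachable.refl a) hab
    have hd := d.adj
    rw [deleteEdges_adj] at hd
    exact ⟨_, _, (hgg _ _ hd.1 h₁ h₂).resolve_left hd.2, h₁, h₂⟩
  have hne : e ≠ f := by
    rintro rfl
    exact h (by simpa using he)
  obtain ⟨u₁, v₁, hf', h₁⟩ := key e f hcross he
  obtain ⟨u₂, v₂, he', h₂⟩ := key f e (fun u v a b c => (hcross u v a b c).symm) hf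
  refine ⟨A, fun u v huv => ⟨?_, ?_⟩⟩
  · have : Xor (A u) (A v) → s(u, v) = e ∨ s(u, v) = f := by
      rintro (h | h)
      · exact hcross _ _ huv h.1 h.2
      · rw [Sym2.eq_swap]; exact hcross _ _ huv.symm h.1 h.2
    intro hx
    rcases this hx with h | h
    · exact Or.inl ⟨h, fun h' => hne (h.symm.trans h')⟩
    · exact Or.inr ⟨h, fun h' => hne (h'.symm.trans h)⟩
  · rintro (h | h)
    · rcases Sym2.eq_iff.1 (h.1.trans he'.symm) with ⟨rfl, rfl⟩ | ⟨rfl, rfl⟩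
      · exact Or.inl h₂
      · exact Or.inr h₂
    · rcases Sym2.eq_iff.1 (h.1.trans hf'.symm) with ⟨rfl, rfl⟩ | ⟨rfl, rfl⟩
      · exact Or.inl h₁
      · exact Or.inr h₁

/-- An edge outside a spanning tree meets, at each end, another edge that is not a bridge. -/
theorem exists_adj_connected_deleteEdges {T : SimpleGraph V} (hTG : T ≤ G) (hT : T.Connected)
    {x y : V} (hxy : G.Adj x y) (hxyT : ¬ T.Adj x y) :
    ∃ z, z ≠ y ∧ G.Adj x z ∧ (G.deleteEdges {s(x, z)}).Connected := by
  classical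
  obtain ⟨p, hp⟩ := hT.exists_isPath x y
  cases p with
  | nil => exact absurd rfl hxy.ne
  | @cons _ z _ hxz p =>
    have hzy : z ≠ y := fun h => hxyT (h ▸ hxz)
    refine ⟨z, hzy, hTG hxz, ?_⟩
    refine (hT.mono hTG).connected_delete_edge_of_not_isBridge ?_
    rw [isBridge_iff_forall_walk_mem_edges, not_forall]
    refine ⟨.cons hxy (p.reverse.mapLe hTG), ?_⟩
    have hx : x ∉ p.support := (Walk.cons_isPath_iff _ _).1 hp |>.2
    simp only [Walk.edges_cons, Walk.edges_mapLe_eq_edges, Walk.edges_reverse, List.mem_cons,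
      List.mem_reverse, not_or]
    exact ⟨fun h => hzy (Sym2.congr_right.1 h), fun h => hx (p.fst_mem_support_of_mem_edges h)⟩

theorem card_edgeSet_le_of_not_connected_deleteEdges [Fintype V] (hG : G.Connected)
    (h : ∀ x y z, G.Adj x y → G.Adj x z → y ≠ z →
      ¬ (G.deleteEdges {s(x, y), s(x, z)}).Connected) :
    G.edgeSet.ncard + 1 ≤ Fintype.card V + Fintype.card V / 3 := by
  classical
  obtain ⟨T, hTG, hT⟩ := hG.exists_isTree_le
  let P : Sym2 V → Finset V := fun e => {v | ∃ w, G.Adj v w ∧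
    (G.deleteEdges {s(v, w)}).Connected ∧ G.Coparallel s(v, w) e}
  have hthree : ∀ e ∈ G.edgeFinset \ T.edgeFinset, 3 ≤ (P e).card := by
    intro e he
    induction e with | _ x y =>
    simp only [Finset.mem_sdiff, mem_edgeFinset, mem_edgeSet] at he
    obtain ⟨hxy, hxyT⟩ := he
    obtain ⟨z, hzy, hxz, hz⟩ := exists_adj_connected_deleteEdges hTG hT.connected hxy hxyT
    have hy : (G.deleteEdges {s(x, y)}).Connected := hT.connected.mono fun u v huv =>
      (deleteEdges_adj ..).2 ⟨hTG huv, fun h => hxyT (by rwa [← mem_edgeSet, ← h])⟩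
    rw [← Finset.card_eq_three.2 ⟨x, y, z, hxy.ne, hxz.ne, hzy.symm, rfl⟩]
    refine Finset.card_le_card ?_
    simp only [Finset.insert_subset_iff, Finset.singleton_subset_iff, P, Finset.mem_filter,
      Finset.mem_univ, true_and]
    refine ⟨⟨y, hxy, hy, .refl _⟩, ⟨x, hxy.symm, ?_, ?_⟩, ⟨x, hxz.symm, ?_, ?_⟩⟩ <;>
      rw [Sym2.eq_swap]
    exacts [hy, .refl _, hz, coparallel_of_not_connected hz hy (h x z y hxz hxy hzy)]
  have hdisj : (↑(G.edgeFinset \ T.edgeFinset) : Set (Sym2 V)).PairwiseDisjoint P := by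
    intro e he f hf hef
    rw [Function.onFun, Finset.disjoint_left]
    intro v hv hv'
    simp only [P, Finset.mem_filter, Finset.mem_univ, true_and] at hv hv'
    obtain ⟨w, hw, hwc, hwe⟩ := hv
    obtain ⟨w', hw', hwc', hwf⟩ := hv'
    simp only [Finset.coe_sdiff, coe_edgeFinset, Set.mem_sdiff] at he hf
    refine not_coparallel_of_notMem hTG hT.connected he.1 he.2 hf.2 hef (hwe.symm.trans ?_)
    rcases eq_or_ne w w' with rfl | hne
    · exact hwf
    · exact (coparallel_of_not_connected hwc hwc' (h v w w' hw hw' hne)).trans hwf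
  have hle : (G.edgeFinset \ T.edgeFinset).card * 3 ≤ Fintype.card V := by
    refine (Finset.card_nsmul_le_sum _ (fun e => (P e).card) 3 hthree).trans ?_
    rw [← Finset.card_biUnion hdisj]
    exact Finset.card_le_univ _
  have hsub := Finset.card_sdiff_add_card_eq_card (edgeFinset_mono hTG)
  have hcard := hT.card_edgeFinset
  rw [← coe_edgeFinset, Set.ncard_coe_finset]
  omega

/-- The path `0, 1, …, n - 1` together with the edges closing the triangles
`3k, 3k + 1, 3k + 2`. -/
def trianglePath (n : ℕ) : SimpleGraph (Fin n) :=
  fromRel fun i j => i.val + 1 = j.val ∨ i.val % 3 = 0 ∧ i.val + 2 = j.val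

theorem trianglePath_adj {n : ℕ} {i j : Fin n} : (trianglePath n).Adj i j ↔
    (i.val + 1 = j.val ∨ i.val % 3 = 0 ∧ i.val + 2 = j.val) ∨
      (j.val + 1 = i.val ∨ j.val % 3 = 0 ∧ j.val + 2 = i.val) := by
  rw [trianglePath, fromRel_adj, Fin.ne_iff_vne]
  omega

theorem trianglePath_connected {n : ℕ} (hn : 0 < n) : (trianglePath n).Connected := by
  refine (connected_iff_exists_forall_reachable _).2 ⟨⟨0, hn⟩, ?_⟩
  rintro ⟨i, hi⟩
  induction i with
  | zero => exact .rfl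
  | succ i ih =>
    exact (ih (by omega)).trans (Adj.reachable (trianglePath_adj.2 (by simp)))

theorem le_card_edgeSet_trianglePath {r n : ℕ} (hr : 0 < r) (hn : 3 * r ≤ n) :
    n - 1 + r ≤ (trianglePath n).edgeSet.ncard := by
  let f : Fin (n - 1) ⊕ Fin r → (trianglePath n).edgeSet := Sum.elim
    (fun i => ⟨s(⟨i, by omega⟩, ⟨i + 1, by omega⟩), trianglePath_adj.2 (by simp)⟩)
    (fun k => ⟨s(⟨3 * k, by omega⟩, ⟨3 * k + 2, by omega⟩), trianglePath_adj.2 (by simp)⟩)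
  have hf : Function.Injective f := by
    rintro (i | i) (j | j) hij <;>
      have hij := Sym2.eq_iff.1 (congrArg Subtype.val hij) <;>
      simp only [Fin.mk.injEq] at hij
    · congr 1; ext; omega
    · omega
    · omega
    · congr 1; ext; omega
  simpa [Nat.card_coe_set_eq] using Nat.card_le_card_of_injective f hf

theorem not_disjoint_edgeSet_trianglePath {n : ℕ} {S : Finset (Fin n)} (hS : S.card = 3)
    {T₁ T₂ : (trianglePath n).Subgraph} (h₁ : (trianglePath n).IsSteinerTree S T₁)
    (h₂ : (trianglePath n).IsSteinerTree S T₂) : ¬ Disjoint T₁.edgeSet T₂.edgeSet := by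
  intro hd
  obtain ⟨a, b, c, hab, hbc, ha, hb, hc⟩ : ∃ a b c : Fin n, a < b ∧ b < c ∧
      a ∈ (S : Set (Fin n)) ∧ b ∈ (S : Set (Fin n)) ∧ c ∈ (S : Set (Fin n)) :=
    ⟨S.orderEmbOfFin hS 0, S.orderEmbOfFin hS 1, S.orderEmbOfFin hS 2, by simp, by simp,
      S.orderEmbOfFin_mem hS _, S.orderEmbOfFin_mem hS _, S.orderEmbOfFin_mem hS _⟩
  rw [Fin.lt_def] at hab hbc
  let D (T : (trianglePath n).Subgraph) (p q : ℕ) : Prop :=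
    ∃ u v : Fin n, u.val = p ∧ v.val = q ∧ T.Adj u v
  have hD : ∀ p q, D T₁ p q → D T₂ p q → False := by
    rintro p q ⟨u, v, rfl, rfl, hu⟩ ⟨u', v', hu', hv', h⟩
    rw [Fin.ext hu', Fin.ext hv'] at h
    exact Set.disjoint_left.1 hd (show s(u, v) ∈ T₁.edgeSet from hu) h
  -- The edges across the cut between `{0, …, i}` and the rest.
  have hprefix : ∀ T, (trianglePath n).IsSteinerTree S T → ∀ i, a.val ≤ i → i < c.val →
      D T i (i + 1) ∨ (i % 3 = 0 ∧ D T i (i + 2)) ∨ (i % 3 = 1 ∧ D T (i - 1) (i + 1)) := by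
    intro T hT i hi hi'
    obtain ⟨u, v, huv, hu, hv⟩ :=
      hT.exists_adj_crossing (fun w => w.val ≤ i) ha hc hi (by omega)
    rcases trianglePath_adj.1 huv.adj_sub with (h | h) | h
    · exact .inl ⟨u, v, by omega, by omega, huv⟩
    · rcases eq_or_ne u.val i with h' | h'
      · exact .inr (.inl ⟨by omega, u, v, by omega, by omega, huv⟩)
      · exact .inr (.inr ⟨by omega, u, v, by omega, by omega, huv⟩)
    · omega
  have hgap : ∀ i, a.val ≤ i → i < c.val → i % 3 ≠ 2 := by
    intro i hi hi' h
    have hi₂ : ∀ T, (trianglePath n).IsSteinerTree S T → D T i (i + 1) := fun T hT => by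
      rcases hprefix T hT i hi hi' with k | ⟨k, -⟩ | ⟨k, -⟩
      · exact k
      all_goals omega
    exact hD i (i + 1) (hi₂ T₁ h₁) (hi₂ T₂ h₂)
  have := hgap (a + (2 - a % 3))
  obtain ⟨ha₀, hb₁, hc₂⟩ : a.val % 3 = 0 ∧ b.val = a + 1 ∧ c.val = a + 2 := by omega
  have hmiddle : ∀ T, (trianglePath n).IsSteinerTree S T →
      D T a (a + 1) ∨ D T (a + 1) (a + 2) := by
    intro T hT
    obtain ⟨u, v, huv, rfl, hv⟩ := hT.exists_adj_crossing (· = b) hb ha rfl (by omega)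
    rcases trianglePath_adj.1 huv.adj_sub with h | h
    · exact .inr ⟨u, v, by omega, by omega, huv⟩
    · exact .inl ⟨v, u, by omega, by omega, huv.symm⟩
  have hleft : ∀ T, (trianglePath n).IsSteinerTree S T → D T a (a + 1) ∨ D T a (a + 2) := by
    intro T hT
    rcases hprefix T hT a le_rfl (by omega) with h | h | h
    · exact .inl h
    · exact .inr h.2
    · omega
  have hright : ∀ T, (trianglePath n).IsSteinerTree S T →
      D T (a + 1) (a + 2) ∨ D T a (a + 2) := by
    intro T hT
    rcases hprefix T hT (a + 1) (by omega) (by omega) with h | h | h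
    · exact .inl h
    · omega
    · exact .inr h.2
  rcases hmiddle T₁ h₁ with h | h
  · have h' := (hleft T₂ h₂).resolve_left (hD _ _ h)
    have k := (hright T₁ h₁).resolve_right fun k => hD _ _ k h'
    exact (hmiddle T₂ h₂).elim (hD _ _ h) (hD _ _ k)
  · have h' := (hright T₂ h₂).resolve_left (hD _ _ h)
    have k := (hleft T₁ h₁).resolve_right fun k => hD _ _ k h'
    exact (hmiddle T₂ h₂).elim (hD _ _ k) (hD _ _ h)

end SimpleGraph


/-- For `n = 3r + q`, `r ≥ 1`, `0 ≤ q ≤ 2`, the maximum number of edges of a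
connected graph on `n` vertices with `κ̄₃ = 1` is `(4n - 3 - q)/3`, and it is attained. -/
theorem stmt_5 (r q n : ℕ) (hr : 1 ≤ r) (hq : q ≤ 2) (hn : n = 3 * r + q) :
    IsGreatest {m : ℕ | ∃ G : SimpleGraph (Fin n),
        G.Connected ∧ G.kappaBar 3 = 1 ∧ G.edgeSet.ncard = m}
      ((4 * n - 3 - q) / 3) := by
  have hbound : ∀ G : SimpleGraph (Fin n), G.Connected → G.kappaBar 3 = 1 →
      G.edgeSet.ncard ≤ (4 * n - 3 - q) / 3 := by
    intro G hG hk
    have := card_edgeSet_le_of_not_connected_deleteEdges hG fun x y z hxy hxz hyz h => by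
      have := two_le_kappaBar_of_connected_deleteEdges hxy hxz hyz h
      omega
    rw [Fintype.card_fin] at this
    omega
  have hconn : (trianglePath n).Connected := trianglePath_connected (by omega)
  have hk : (trianglePath n).kappaBar 3 = 1 :=
    kappaBar_three_eq_one hconn (by rw [Nat.card_fin]; omega) fun _ hS _ _ =>
      not_disjoint_edgeSet_trianglePath hS
  refine ⟨⟨trianglePath n, hconn, hk, (hbound _ hconn hk).antisymm ?_⟩, ?_⟩
  · have := le_card_edgeSet_trianglePath hr (show 3 * r ≤ n by omega)
    omega
  · rintro m ⟨G, hG, hGk, rfl⟩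
    exact hbound G hG hGk
end

section
/- Let G be a connected graph with 5 vertices and at least 7 edges. Then κ̄₄(G) ≥ 2. -/
open SimpleGraph

theorem SimpleGraph.Walk.IsPath.isTree_toSubgraph {V : Type*} {G : SimpleGraph V} {u v : V}
    {p : G.Walk u v} (hp : p.IsPath) : p.toSubgraph.coe.IsTree := by
  classical
  have : Finite p.toSubgraph.verts := by
    rw [Walk.verts_toSubgraph]
    exact p.support.finite_toSet
  rw [isTree_iff_connected_and_card]
  refine ⟨p.toSubgraph_connected, ?_⟩
  have hinj : Function.Injective (Sym2.map (Subtype.val : p.toSubgraph.verts → V)) :=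
    Sym2.map.injective Subtype.val_injective
  have h₁ : Nat.card p.toSubgraph.coe.edgeSet = p.length := by
    rw [Nat.card_coe_set_eq, ← Set.ncard_image_of_injective _ hinj,
      Subgraph.image_coe_edgeSet_coe, Walk.edgeSet_toSubgraph, ← Walk.coe_edges_toFinset,
      Set.ncard_coe_finset, List.toFinset_card_of_nodup hp.edges_nodup, Walk.length_edges]
  have h₂ : Nat.card p.toSubgraph.verts = p.length + 1 := by
    rw [Nat.card_coe_set_eq, Walk.verts_toSubgraph, ← List.coe_toFinset,
      Set.ncard_coe_finset, List.toFinset_card_of_nodup hp.support_nodup, Walk.length_support]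
  rw [h₁, h₂]

theorem SimpleGraph.IsSteinerTree.edgeSet_nonempty_s8 {V : Type*} {G : SimpleGraph V} {S : Set V}
    {T : G.Subgraph} (hT : G.IsSteinerTree S T) (hS : S.Nontrivial) : T.edgeSet.Nonempty := by
  obtain ⟨a, ha, b, hb, hab⟩ := hS
  have : Nontrivial T.verts := ⟨⟨a, hT.1 ha⟩, ⟨b, hT.1 hb⟩, by simpa using hab⟩
  obtain ⟨c, hc⟩ := hT.2.1.preconnected.exists_adj_of_nontrivial ⟨a, hT.1 ha⟩
  exact ⟨s(a, c), hc⟩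

theorem SimpleGraph.le_steinerConn_s8 {V : Type*} [Finite V] {G : SimpleGraph V} {S : Set V}
    (hS : S.Nontrivial) {n : ℕ} (f : Fin n → G.Subgraph) (hf : ∀ i, G.IsSteinerTree S (f i))
    (hd : ∀ i j, i ≠ j →
      (f i).edgeSet ∩ (f j).edgeSet = ∅ ∧ (f i).verts ∩ (f j).verts = S) :
    n ≤ G.steinerConn S := by
  refine le_csSup ⟨Nat.card (Sym2 V), ?_⟩ ⟨f, hf, hd⟩
  rintro m ⟨g, hg, hgd⟩
  choose e he using fun i => (hg i).edgeSet_nonempty_s8 hS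
  have hinj : Function.Injective e := fun i j hij => by
    by_contra hne
    exact Set.notMem_empty (e i) ((hgd i j hne).1 ▸ ⟨he i, hij ▸ he j⟩)
  simpa using Nat.card_le_card_of_injective e hinj

theorem SimpleGraph.steinerConn_le_kappaBar_s8 {V : Type*} [Finite V] (G : SimpleGraph V)
    (S : Finset V) : G.steinerConn ↑S ≤ G.kappaBar S.card := by
  refine le_csSup (Set.Finite.bddAbove ?_) ⟨S, rfl, rfl⟩
  refine (Set.finite_range fun S : Finset V => G.steinerConn ↑S).subset ?_
  rintro m ⟨S', -, h⟩
  exact ⟨S', h⟩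

theorem SimpleGraph.two_le_kappaBar_of_isPath {V : Type*} [Finite V] {G : SimpleGraph V}
    {u v w z : V} {p : G.Walk u v} {q : G.Walk w z} (hp : p.IsPath) (hq : q.IsPath)
    (hpq : p.support ⊆ q.support) (hlen : 0 < p.length) (hd : p.edges.Disjoint q.edges) :
    2 ≤ G.kappaBar (p.length + 1) := by
  classical
  have hcard : p.support.toFinset.card = p.length + 1 := by
    rw [List.toFinset_card_of_nodup hp.support_nodup, Walk.length_support]
  rw [← hcard]
  refine le_trans ?_ (G.steinerConn_le_kappaBar_s8 _)
  have hverts : p.toSubgraph.verts ∩ q.toSubgraph.verts = ↑p.support.toFinset := by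
    ext y
    simpa using fun h => hpq h
  have hedges : p.toSubgraph.edgeSet ∩ q.toSubgraph.edgeSet = ∅ := by
    ext y
    simpa using fun h => hd h
  refine le_steinerConn_s8 (Finset.one_lt_card_iff_nontrivial.1 (by omega))
    ![p.toSubgraph, q.toSubgraph] ?_ ?_
  · rw [Fin.forall_fin_two]
    refine ⟨⟨?_, hp.isTree_toSubgraph⟩, ⟨?_, hq.isTree_toSubgraph⟩⟩ <;> rw [← hverts]
    exacts [Set.inter_subset_left, Set.inter_subset_right]
  · intro i j hij
    fin_cases i <;> fin_cases j
    exacts [absurd rfl hij, ⟨hedges, hverts⟩,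
      ⟨(Set.inter_comm _ _).trans hedges, (Set.inter_comm _ _).trans hverts⟩, absurd rfl hij]

/-- The adjacencies of a path `a b c d` together with those of a second, edge-disjoint path
through `a`, `b`, `c`, `d` and possibly one more vertex. -/
def HasTwoPaths {V : Type*} (A : V → V → Prop) : Prop :=
  ∃ a b, A a b ∧ ∃ c, A b c ∧ a ≠ c ∧ ∃ d, A c d ∧ a ≠ d ∧ b ≠ d ∧
    ((A b d ∧ A d a ∧ A a c) ∨ ∃ x, x ∉ [a, b, c, d] ∧
      ((A d b ∧ A b x ∧ A x c ∧ A c a) ∨ (A d a ∧ A a c ∧ A c x ∧ A x b) ∨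
        (A c a ∧ A a x ∧ A x d ∧ A d b)))

instance {A : Fin 5 → Fin 5 → Prop} [DecidableRel A] : Decidable (HasTwoPaths A) := by
  unfold HasTwoPaths
  infer_instance

theorem HasTwoPaths.map {V W : Type*} {A : V → V → Prop} {B : W → W → Prop} (f : V ↪ W)
    (hf : ∀ a b, A a b → B (f a) (f b)) (h : HasTwoPaths A) : HasTwoPaths B := by
  obtain ⟨a, b, hab, c, hbc, hac, d, hcd, had, hbd, h⟩ := h
  refine ⟨f a, f b, hf _ _ hab, f c, hf _ _ hbc, f.injective.ne hac, f d, hf _ _ hcd,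
    f.injective.ne had, f.injective.ne hbd, ?_⟩
  obtain ⟨h₁, h₂, h₃⟩ | ⟨x, hx, h⟩ := h
  · exact .inl ⟨hf _ _ h₁, hf _ _ h₂, hf _ _ h₃⟩
  · refine .inr ⟨f x, by simpa using hx, ?_⟩
    exact h.imp (fun h => ⟨hf _ _ h.1, hf _ _ h.2.1, hf _ _ h.2.2.1, hf _ _ h.2.2.2⟩)
      (Or.imp (fun h => ⟨hf _ _ h.1, hf _ _ h.2.1, hf _ _ h.2.2.1, hf _ _ h.2.2.2⟩)
        (fun h => ⟨hf _ _ h.1, hf _ _ h.2.1, hf _ _ h.2.2.1, hf _ _ h.2.2.2⟩))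

theorem HasTwoPaths.two_le_kappaBar {V : Type*} [Finite V] {G : SimpleGraph V}
    (h : HasTwoPaths G.Adj) : 2 ≤ G.kappaBar 4 := by
  obtain ⟨a, b, hab, c, hbc, hac, d, hcd, had, hbd, h⟩ := h
  let p : G.Walk a d := .cons hab (.cons hbc (.cons hcd .nil))
  have hp : p.IsPath := by
    have h₁ := hab.ne
    have h₂ := hbc.ne
    have h₃ := hcd.ne
    simp [p, Walk.isPath_def, *]
  suffices ∃ (w z : V) (q : G.Walk w z), q.IsPath ∧ p.support ⊆ q.support ∧
      p.edges.Disjoint q.edges by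
    obtain ⟨w, z, q, hq, hs, hd⟩ := this
    exact two_le_kappaBar_of_isPath hp hq hs (by simp [p]) hd
  obtain ⟨h₁, h₂, h₃⟩ | ⟨x, hx, ⟨h₁, h₂, h₃, h₄⟩ | ⟨h₁, h₂, h₃, h₄⟩ | ⟨h₁, h₂, h₃, h₄⟩⟩ := h
  · refine ⟨_, _, .cons h₁ (.cons h₂ (.cons h₃ .nil)), ?_, ?_, ?_⟩ <;>
      simp [p, Walk.isPath_def] at * <;> grind
  all_goals
    refine ⟨_, _, .cons h₁ (.cons h₂ (.cons h₃ (.cons h₄ .nil))), ?_, ?_, ?_⟩ <;>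
      simp [p, Walk.isPath_def] at * <;> grind

/-- An injective numbering of the edges of the complete graph on `Fin 5`. -/
def edgeCode : Sym2 (Fin 5) → ℕ :=
  Sym2.lift ⟨fun i j => 2 ^ i.val + 2 ^ j.val, fun _ _ => Nat.add_comm _ _⟩

theorem edgeCode_injective : Function.Injective edgeCode := by
  unfold Function.Injective
  decide +kernel

theorem edgeCode_mem : ∀ i j : Fin 5, i ≠ j →
    edgeCode s(i, j) ∈ ({3, 5, 6, 9, 10, 12, 17, 18, 20, 24} : Finset ℕ) := by
  decide +kernel

theorem hasTwoPaths_of_edgeCode :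
    ∀ C ∈ ({3, 5, 6, 9, 10, 12, 17, 18, 20, 24} : Finset ℕ).powersetCard 3,
      HasTwoPaths fun i j : Fin 5 => i ≠ j ∧ 2 ^ i.val + 2 ^ j.val ∉ C := by
  decide +kernel

theorem hasTwoPaths_of_card_eq_three {M : Finset (Sym2 (Fin 5))}
    (hM : M ⊆ (⊤ : SimpleGraph (Fin 5)).edgeFinset) (hM3 : M.card = 3) :
    HasTwoPaths fun i j => i ≠ j ∧ s(i, j) ∉ M := by
  refine (hasTwoPaths_of_edgeCode (M.image edgeCode) (Finset.mem_powersetCard.2 ⟨?_, ?_⟩)).map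
    (.refl _) fun i j ⟨hij, hmem⟩ => ⟨hij, fun h => hmem (Finset.mem_image_of_mem edgeCode h)⟩
  · refine Finset.image_subset_iff.2 fun z hz => ?_
    have hz' := hM hz
    induction z with
    | h i j => exact edgeCode_mem i j (by simpa using hz')
  · rw [Finset.card_image_of_injective _ edgeCode_injective, hM3]

theorem hasTwoPaths_of_seven_le_ncard_edgeSet (G : SimpleGraph (Fin 5))
    (he : 7 ≤ G.edgeSet.ncard) : HasTwoPaths G.Adj := by
  classical
  have hsub : G.edgeFinset ⊆ (⊤ : SimpleGraph (Fin 5)).edgeFinset := edgeFinset_mono le_top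
  have htop : (⊤ : SimpleGraph (Fin 5)).edgeFinset.card = 10 := by
    rw [card_edgeFinset_top_eq_card_choose_two, Fintype.card_fin]
    rfl
  rw [← coe_edgeFinset, Set.ncard_coe_finset] at he
  have hle := Finset.card_sdiff_add_card_eq_card hsub
  obtain ⟨M, hM, hMtop, hM3⟩ := Finset.exists_subsuperset_card_eq
    (n := 3) (Finset.sdiff_subset (s := (⊤ : SimpleGraph (Fin 5)).edgeFinset)
      (t := G.edgeFinset)) (by omega) (by omega)
  refine (hasTwoPaths_of_card_eq_three hMtop hM3).map
    (.refl _) fun i j ⟨hij, hmem⟩ => ?_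
  by_contra hadj
  exact hmem (hM (by simpa [hij] using hadj))

/-- A connected graph with 5 vertices and at least 7 edges has `κ̄₄(G) ≥ 2`. -/
theorem stmt_8 {V : Type*} [Fintype V] (G : SimpleGraph V) (hG : G.Connected)
    (hcard : Fintype.card V = 5) (he : 7 ≤ G.edgeSet.ncard) :
    2 ≤ G.kappaBar 4 := by
  let e : Fin 5 ≃ V := (Fintype.equivFinOfCardEq hcard).symm
  have hiso : (G.comap e).edgeSet.ncard = G.edgeSet.ncard :=
    Nat.card_congr (Iso.comap e G).mapEdgeSet
  exact ((hasTwoPaths_of_seven_le_ncard_edgeSet (G.comap e) (hiso ▸ he)).map e.toEmbedding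
    fun _ _ h => h).two_le_kappaBar
end

section
/- Let G be a connected graph with 6 vertices and at least 8 edges. Then κ̄₄(G) ≥ 2. -/
open SimpleGraph

/-- Attaching a pendant edge to a tree gives a tree. -/
theorem SimpleGraph.Subgraph.isTree_coe_sup_subgraphOfAdj {V : Type*} [Finite V]
    {G : SimpleGraph V} {T : G.Subgraph} (hT : T.coe.IsTree) {u v : V} (hu : u ∈ T.verts)
    (hv : v ∉ T.verts) (h : G.Adj u v) : (T ⊔ G.subgraphOfAdj h).coe.IsTree := by
  have card_edges (H : G.Subgraph) : Nat.card H.coe.edgeSet = H.edgeSet.ncard := by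
    rw [← H.image_coe_edgeSet_coe,
      Set.ncard_image_of_injective _ (Sym2.map.injective Subtype.val_injective),
      Nat.card_coe_set_eq]
  rw [isTree_iff_connected_and_card, card_edges, Nat.card_coe_set_eq] at hT ⊢
  refine ⟨(Subgraph.connected_sup (Subgraph.connected_iff'.2 hT.1).preconnected
    (Subgraph.subgraphOfAdj_connected h).preconnected ⟨u, hu, by simp⟩).coe, ?_⟩
  have hverts : (T ⊔ G.subgraphOfAdj h).verts = insert v T.verts := by
    ext x
    simp only [Subgraph.verts_sup, subgraphOfAdj_verts, Set.mem_union, Set.mem_insert_iff,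
      Set.mem_singleton_iff]
    grind
  have hedges : (T ⊔ G.subgraphOfAdj h).edgeSet = insert s(u, v) T.edgeSet := by
    rw [Subgraph.edgeSet_sup, edgeSet_subgraphOfAdj, Set.union_singleton]
  rw [hverts, hedges, Set.ncard_insert_of_notMem hv, Set.ncard_insert_of_notMem, hT.2]
  exact fun hmem => hv (T.edge_vert (Subgraph.mem_edgeSet.1 hmem).symm)

/-- `GrowsFrom vs t` says that each entry `(u, v)` of `t` attaches a new vertex `v` to a vertex `u`
that occurs in `vs` or was attached before. -/
def GrowsFrom : List ℕ → List (ℕ × ℕ) → Prop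
  | _, [] => True
  | vs, e :: t => e.1 ∈ vs ∧ e.2 ∉ vs ∧ GrowsFrom (e.2 :: vs) t

instance GrowsFrom.decidable : ∀ vs t, Decidable (GrowsFrom vs t)
  | _, [] => inferInstanceAs (Decidable True)
  | vs, e :: t =>
    have := GrowsFrom.decidable (e.2 :: vs) t
    inferInstanceAs (Decidable (_ ∧ _ ∧ _))

/-- The first vertex of a list of edges, followed by the second endpoints of all the edges. -/
def growthVerts (t : List (ℕ × ℕ)) : List ℕ := (t.headD (0, 0)).1 :: t.map Prod.snd

theorem exists_isTree_of_growsFrom {V : Type*} [Finite V] {G : SimpleGraph V} {φ : ℕ → V}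
    {s : Set ℕ} (hφ : s.InjOn φ) (t : List (ℕ × ℕ)) {vs : List ℕ} (ht : GrowsFrom vs t)
    (hvs : ∀ v ∈ vs, v ∈ s) (hts : ∀ e ∈ t, e.2 ∈ s) (hadj : ∀ e ∈ t, G.Adj (φ e.1) (φ e.2))
    {T : G.Subgraph} (hT : T.coe.IsTree) (hTv : T.verts = φ '' {v | v ∈ vs}) :
    ∃ T' : G.Subgraph, T'.coe.IsTree ∧ T'.verts = φ '' {v | v ∈ vs ∨ v ∈ t.map Prod.snd} ∧
      T'.edgeSet = T.edgeSet ∪ {d | ∃ e ∈ t, d = s(φ e.1, φ e.2)} := by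
  induction t generalizing vs T with
  | nil => exact ⟨T, hT, by simpa using hTv, by simp⟩
  | cons e t ih =>
    obtain ⟨h1, h2, h3⟩ := ht
    have he := hadj e (by simp)
    have hnot : φ e.2 ∉ T.verts := by
      rw [hTv]
      rintro ⟨w, hw, hwe⟩
      exact h2 (hφ (hvs w hw) (hts e (by simp)) hwe ▸ hw)
    have hmem : φ e.1 ∈ T.verts := hTv ▸ ⟨e.1, h1, rfl⟩
    obtain ⟨T', hT', hv', he'⟩ := ih h3
      (by simpa using ⟨hts e (by simp), hvs⟩)
      (fun d hd => hts d (by simp [hd])) (fun d hd => hadj d (by simp [hd]))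
      (Subgraph.isTree_coe_sup_subgraphOfAdj hT hmem hnot he) (by
        ext x
        simp only [Subgraph.verts_sup, subgraphOfAdj_verts, hTv, Set.mem_union, Set.mem_image,
          Set.mem_ofPred_eq, Set.mem_insert_iff, Set.mem_singleton_iff, List.mem_cons]
        grind)
    refine ⟨T', hT', ?_, ?_⟩
    · rw [hv']
      congr 1
      ext x
      simp only [Set.mem_ofPred_eq, List.map_cons, List.mem_cons]
      tauto
    · rw [he', Subgraph.edgeSet_sup, edgeSet_subgraphOfAdj]
      ext x
      simp only [Set.mem_union, Set.mem_singleton_iff, Set.mem_ofPred_eq, List.mem_cons]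
      grind

theorem exists_isTree_of_growthVerts {V : Type*} [Finite V] {G : SimpleGraph V} {φ : ℕ → V}
    {t : List (ℕ × ℕ)} (hφ : {v | v ∈ growthVerts t}.InjOn φ)
    (ht : GrowsFrom [(t.headD (0, 0)).1] t) (hadj : ∀ e ∈ t, G.Adj (φ e.1) (φ e.2)) :
    ∃ T : G.Subgraph, T.coe.IsTree ∧ T.verts = φ '' {v | v ∈ growthVerts t} ∧
      T.edgeSet = {d | ∃ e ∈ t, d = s(φ e.1, φ e.2)} := by
  obtain ⟨T, hT, hv, he⟩ := exists_isTree_of_growsFrom hφ t ht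
    (by simp [growthVerts]) (fun e h => by
      simp only [growthVerts, Set.mem_ofPred_eq, List.mem_cons, List.mem_map]
      exact .inr ⟨e, h, rfl⟩) hadj
    (IsTree.coe_singletonSubgraph G (φ (t.headD (0, 0)).1)) (by simp)
  exact ⟨T, hT, by simpa [growthVerts] using hv, by simpa using he⟩

theorem SimpleGraph.two_le_kappaBar {V : Type*} [Finite V] {G : SimpleGraph V} {k : ℕ}
    (hk : 2 ≤ k) {T₁ T₂ : G.Subgraph} (h₁ : T₁.coe.IsTree) (h₂ : T₂.coe.IsTree)
    (hd : T₁.edgeSet ∩ T₂.edgeSet = ∅) (hc : (T₁.verts ∩ T₂.verts).ncard = k) :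
    2 ≤ G.kappaBar k := by
  have := Fintype.ofFinite V
  classical
  set S := (T₁.verts ∩ T₂.verts).toFinset with hS
  have hSc : S.card = k := by rw [← hc, Set.ncard_eq_toFinset_card']
  have hS' : (S : Set V) = T₁.verts ∩ T₂.verts := by simp [hS]
  have hκ : 2 ≤ G.steinerConn S := by
    refine le_csSup ⟨Nat.card G.Subgraph, ?_⟩ ⟨![T₁, T₂], ?_, ?_⟩
    · rintro n ⟨f, hf, hdisj⟩
      have hinj : Function.Injective f := by
        intro i j hij
        by_contra hne
        obtain ⟨he, -⟩ := hdisj i j hne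
        rw [← hij, Set.inter_self] at he
        obtain ⟨a, ha, b, hb, hab⟩ := Finset.one_lt_card.1 (by omega : 1 < S.card)
        have : Nontrivial (f i).verts :=
          ⟨⟨a, (hf i).1 ha⟩, ⟨b, (hf i).1 hb⟩, fun h => hab (congrArg Subtype.val h)⟩
        obtain ⟨c, hc⟩ := (hf i).2.connected.preconnected.exists_adj_of_nontrivial ⟨a, (hf i).1 ha⟩
        exact (he ▸ (Subgraph.mem_edgeSet.2 hc) : s(a, c.1) ∈ (∅ : Set (Sym2 V)))
      simpa using Nat.card_le_card_of_injective f hinj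
    · intro i
      fin_cases i
      · exact ⟨hS' ▸ Set.inter_subset_left, h₁⟩
      · exact ⟨hS' ▸ Set.inter_subset_right, h₂⟩
    · intro i j hij
      fin_cases i <;> fin_cases j
      · exact absurd rfl hij
      · exact ⟨hd, hS'.symm⟩
      · exact ⟨Set.inter_comm _ _ ▸ hd, (Set.inter_comm _ _).trans hS'.symm⟩
      · exact absurd rfl hij
  refine hκ.trans (le_csSup (Set.Finite.bddAbove ?_) ⟨S, hSc, rfl⟩)
  refine (Set.finite_range fun S : Finset V => G.steinerConn S).subset ?_
  rintro m ⟨S, -, rfl⟩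
  exact ⟨S, rfl⟩

/-- `search i b L C` is true if every set of numbers below `i` that misses at most `b` of them
and meets every member of `C` contains a member of `L`. Sets are given by their bits. -/
def search : ℕ → ℕ → List ℕ → List ℕ → Bool
  | 0, _, L, C => L.contains 0 || C.contains 0
  | i + 1, b, L, C => L.contains 0 || C.contains 0 ||
    (search i b (L.map (· % 2 ^ i)) (C.filter (· < 2 ^ i)) &&
      match b with
      | 0 => true
      | b + 1 => search i b (L.filter (· < 2 ^ i)) (C.map (· % 2 ^ i)))

theorem search_sound (r : ℕ → Prop) [DecidablePred r] (i b : ℕ) (L C : List ℕ)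
    (h : search i b L C = true) (hb : i.count (fun k => ¬ r k) ≤ b) :
    (∃ q ∈ L, ∀ k < i, q.testBit k → r k) ∨ (∃ q ∈ C, ∀ k < i, q.testBit k → ¬ r k) := by
  have hzero {i : ℕ} {L C : List ℕ} (hLC : (L.contains 0 || C.contains 0) = true) :
      (∃ q ∈ L, ∀ k < i, q.testBit k → r k) ∨ (∃ q ∈ C, ∀ k < i, q.testBit k → ¬ r k) := by
    simp only [Bool.or_eq_true, List.contains_iff_mem] at hLC
    exact hLC.imp (fun h => ⟨0, h, by simp⟩) (fun h => ⟨0, h, by simp⟩)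
  induction i generalizing b L C with
  | zero => exact hzero h
  | succ i ih =>
    rw [search.eq_def, Bool.or_eq_true] at h
    refine h.elim hzero fun h => ?_
    rw [Bool.and_eq_true] at h
    have hmod {q k : ℕ} (hk : k < i) : (q % 2 ^ i).testBit k = q.testBit k := by
      simp [Nat.testBit_mod_two_pow, hk]
    have hlast {p : ℕ → Prop} {q : ℕ} (hq : ∀ k < i, q.testBit k → p k)
        (hi : q.testBit i → p i) : ∀ k < i + 1, q.testBit k → p k := by
      intro k hk
      rcases Nat.lt_succ_iff_lt_or_eq.1 hk with hk | rfl
      exacts [hq k hk, hi]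
    have hsmall {q : ℕ} (hq : decide (q < 2 ^ i) = true) : q.testBit i = false :=
      Nat.testBit_lt_two_pow (of_decide_eq_true hq)
    rw [Nat.count_succ] at hb
    by_cases hr : r i
    · obtain ⟨q, hq, hqr⟩ | ⟨q, hq, hqr⟩ := ih b _ _ h.1 (by simpa [hr] using hb)
      · obtain ⟨q, hqL, rfl⟩ := List.mem_map.1 hq
        exact .inl ⟨q, hqL, hlast (fun k hk hkq => hqr k hk (by rwa [hmod hk])) fun _ => hr⟩
      · obtain ⟨hqC, hqi⟩ := List.mem_filter.1 hq
        exact .inr ⟨q, hqC, hlast hqr fun h => by simp [hsmall hqi] at h⟩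
    · cases b with
      | zero => simp [hr] at hb
      | succ b =>
        obtain ⟨q, hq, hqr⟩ | ⟨q, hq, hqr⟩ := ih b _ _ h.2 (by simpa [hr] using hb)
        · obtain ⟨hqL, hqi⟩ := List.mem_filter.1 hq
          exact .inl ⟨q, hqL, hlast hqr fun h => by simp [hsmall hqi] at h⟩
        · obtain ⟨q, hqC, rfl⟩ := List.mem_map.1 hq
          exact .inr ⟨q, hqC, hlast (fun k hk hkq => hqr k hk (by rwa [hmod hk])) fun _ => hr⟩

/-- The position of the edge `{i, j}` when pairs of natural numbers are ordered
colexicographically. -/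
def edgeIndex (i j : ℕ) : ℕ := max i j * (max i j - 1) / 2 + min i j

theorem edgeIndex_comm (i j : ℕ) : edgeIndex i j = edgeIndex j i := by
  simp only [edgeIndex, max_comm, min_comm]

theorem edgeIndex_lt_fifteen : ∀ i < 6, ∀ j < 6, i ≠ j → edgeIndex i j < 15 := by
  decide +kernel

theorem edgeIndex_inj : ∀ i j k l : Fin 6, i ≠ j → k ≠ l →
    edgeIndex i j = edgeIndex k l → i = k ∧ j = l ∨ i = l ∧ j = k := by
  decide +kernel

/-- The set of positions of the edges in `es`, after relabelling the vertices by `σ`. -/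
def edgeMask (σ : ℕ → ℕ) (es : List (ℕ × ℕ)) : ℕ :=
  es.foldr (fun e m => 2 ^ edgeIndex (σ e.1) (σ e.2) ||| m) 0

theorem testBit_edgeMask (σ : ℕ → ℕ) (es : List (ℕ × ℕ)) (k : ℕ) :
    (edgeMask σ es).testBit k = true ↔ ∃ e ∈ es, edgeIndex (σ e.1) (σ e.2) = k := by
  induction es with
  | nil => simp [edgeMask]
  | cons e es ih =>
    rw [edgeMask, List.foldr_cons, Nat.testBit_or, Bool.or_eq_true, Nat.testBit_two_pow,
      decide_eq_true_iff, ← edgeMask, ih]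
    simp

/-- Pairs of edge-disjoint trees with exactly four common vertices. -/
def treePairs : List (List (ℕ × ℕ) × List (ℕ × ℕ)) :=
  [([(0, 5), (5, 2), (2, 1)], [(0, 1), (0, 2), (1, 5)]),
   ([(1, 5), (5, 4), (4, 2)], [(1, 2), (1, 4), (2, 5)]),
   ([(2, 5), (5, 4), (4, 3)], [(2, 3), (2, 4), (3, 5)]),
   ([(1, 2), (1, 4), (4, 5)], [(0, 1), (0, 2), (0, 4), (2, 5)]),
   ([(1, 4), (4, 2), (4, 5)], [(0, 1), (0, 4), (1, 2), (2, 5)]),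
   ([(1, 4), (4, 2), (4, 5)], [(0, 2), (0, 4), (2, 1), (2, 5)]),
   ([(1, 4), (4, 5), (5, 2)], [(0, 1), (0, 2), (0, 4), (1, 5)]),
   ([(1, 4), (4, 5), (5, 2)], [(0, 1), (0, 4), (1, 2), (1, 5)]),
   ([(1, 4), (4, 5), (5, 2)], [(0, 1), (0, 4), (1, 5), (4, 2)]),
   ([(1, 4), (4, 5), (5, 2)], [(0, 2), (0, 4), (2, 1), (1, 5)]),
   ([(1, 5), (5, 2), (5, 4)], [(0, 1), (0, 2), (0, 5), (1, 4)]),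
   ([(1, 5), (5, 2), (5, 4)], [(0, 1), (0, 5), (1, 2), (1, 4)]),
   ([(1, 5), (5, 2), (5, 4)], [(0, 1), (0, 5), (1, 4), (4, 2)]),
   ([(1, 5), (5, 2), (5, 4)], [(0, 2), (0, 5), (2, 4), (4, 1)]),
   ([(1, 5), (5, 2), (5, 4)], [(0, 4), (0, 5), (4, 1), (1, 2)]),
   ([(1, 5), (5, 2), (5, 4)], [(0, 4), (0, 5), (4, 1), (4, 2)]),
   ([(1, 5), (5, 4), (4, 2)], [(0, 1), (0, 2), (0, 4), (2, 5)]),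
   ([(1, 5), (5, 4), (4, 2)], [(0, 1), (0, 2), (1, 4), (2, 5)]),
   ([(1, 5), (5, 4), (4, 2)], [(0, 2), (0, 4), (4, 1), (2, 5)]),
   ([(2, 5), (5, 3), (5, 4)], [(1, 2), (1, 3), (1, 4), (1, 5)]),
   ([(2, 5), (5, 3), (5, 4)], [(1, 2), (1, 4), (1, 5), (4, 3)]),
   ([(2, 5), (5, 3), (5, 4)], [(1, 3), (1, 5), (3, 4), (4, 2)]),
   ([(2, 5), (5, 3), (5, 4)], [(1, 4), (1, 5), (4, 2), (4, 3)]),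
   ([(2, 5), (5, 4), (4, 3)], [(1, 2), (1, 3), (1, 4), (3, 5)]),
   ([(2, 5), (5, 4), (4, 3)], [(1, 2), (1, 3), (2, 4), (3, 5)]),
   ([(2, 5), (5, 4), (4, 3)], [(1, 3), (1, 4), (4, 2), (3, 5)]),
   ([(0, 1), (0, 2), (2, 5), (5, 4)], [(1, 2), (1, 5), (5, 3), (3, 4)]),
   ([(0, 1), (0, 3), (3, 5), (5, 4)], [(1, 3), (3, 4), (4, 2), (2, 5)]),
   ([(0, 1), (0, 4), (4, 5), (5, 3)], [(1, 2), (1, 3), (1, 4), (2, 5)]),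
   ([(0, 1), (0, 4), (4, 5), (5, 3)], [(1, 2), (1, 4), (2, 5), (4, 3)]),
   ([(0, 1), (0, 4), (4, 5), (5, 3)], [(1, 3), (1, 4), (3, 2), (2, 5)]),
   ([(0, 1), (0, 4), (4, 5), (5, 3)], [(1, 4), (4, 2), (2, 5), (4, 3)]),
   ([(0, 1), (0, 5), (5, 2), (5, 4)], [(1, 2), (1, 5), (5, 3), (3, 4)]),
   ([(0, 1), (0, 5), (5, 3), (5, 4)], [(1, 5), (5, 2), (2, 4), (4, 3)]),
   ([(0, 2), (0, 3), (0, 4), (4, 5)], [(1, 4), (1, 5), (5, 2), (5, 3)]),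
   ([(0, 2), (0, 3), (3, 5), (5, 4)], [(1, 2), (1, 4), (2, 5), (4, 3)]),
   ([(0, 2), (0, 3), (3, 5), (5, 4)], [(1, 4), (1, 5), (5, 2), (4, 3)]),
   ([(0, 2), (0, 4), (2, 5), (5, 3)], [(1, 2), (1, 5), (5, 4), (4, 3)]),
   ([(0, 2), (0, 4), (4, 3), (4, 5)], [(1, 3), (1, 4), (3, 5), (5, 2)]),
   ([(0, 2), (0, 4), (4, 5), (5, 3)], [(1, 2), (1, 4), (2, 5), (4, 3)]),
   ([(0, 2), (0, 4), (4, 5), (5, 3)], [(1, 3), (1, 4), (1, 5), (5, 2)]),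
   ([(0, 2), (0, 4), (4, 5), (5, 3)], [(1, 4), (1, 5), (5, 2), (4, 3)]),
   ([(0, 2), (0, 5), (5, 1), (5, 4)], [(1, 2), (2, 5), (5, 3), (3, 4)]),
   ([(0, 2), (0, 5), (5, 3), (5, 4)], [(1, 3), (1, 4), (1, 5), (5, 2)]),
   ([(0, 2), (0, 5), (5, 3), (5, 4)], [(1, 4), (1, 5), (5, 2), (4, 3)]),
   ([(0, 3), (0, 4), (4, 5), (5, 2)], [(1, 2), (1, 3), (1, 4), (3, 5)]),
   ([(0, 3), (0, 4), (4, 5), (5, 2)], [(1, 2), (1, 5), (5, 3), (3, 4)]),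
   ([(1, 4), (4, 5), (5, 3)], [(0, 1), (0, 2), (0, 4), (1, 3), (2, 5)]),
   ([(2, 5), (5, 3), (5, 4)], [(0, 1), (0, 2), (0, 3), (0, 4), (1, 5)]),
   ([(2, 5), (5, 3), (5, 4)], [(0, 1), (0, 2), (0, 3), (1, 4), (1, 5)]),
   ([(2, 5), (5, 3), (5, 4)], [(0, 1), (0, 2), (0, 4), (1, 5), (4, 3)]),
   ([(2, 5), (5, 3), (5, 4)], [(0, 1), (0, 2), (1, 3), (1, 4), (1, 5)]),
   ([(2, 5), (5, 3), (5, 4)], [(0, 1), (0, 2), (1, 4), (1, 5), (4, 3)]),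
   ([(2, 5), (5, 3), (5, 4)], [(0, 1), (0, 3), (1, 5), (3, 4), (4, 2)]),
   ([(2, 5), (5, 3), (5, 4)], [(0, 1), (0, 4), (1, 2), (1, 5), (4, 3)]),
   ([(2, 5), (5, 3), (5, 4)], [(0, 1), (0, 4), (1, 5), (4, 2), (4, 3)]),
   ([(2, 5), (5, 4), (4, 3)], [(0, 1), (0, 2), (1, 3), (1, 4), (3, 5)]),
   ([(2, 5), (5, 4), (4, 3)], [(0, 1), (0, 2), (1, 3), (2, 4), (3, 5)]),
   ([(2, 5), (5, 4), (4, 3)], [(0, 1), (0, 3), (1, 2), (1, 4), (3, 5)]),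
   ([(2, 5), (5, 4), (4, 3)], [(0, 1), (0, 3), (1, 4), (4, 2), (3, 5)])]

theorem treePairs_spec : ∀ p ∈ treePairs,
    GrowsFrom [(p.1.headD (0, 0)).1] p.1 ∧ GrowsFrom [(p.2.headD (0, 0)).1] p.2 ∧
    (∀ e ∈ p.1 ++ p.2, e.1 < 6 ∧ e.2 < 6 ∧ e.1 ≠ e.2) ∧
    (∀ v ∈ growthVerts p.1 ++ growthVerts p.2, v < 6) ∧
    (∀ d ∈ p.1, ∀ e ∈ p.2, ¬ (d.1 = e.1 ∧ d.2 = e.2) ∧ ¬ (d.1 = e.2 ∧ d.2 = e.1)) ∧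
    ((growthVerts p.1).toFinset ∩ (growthVerts p.2).toFinset).card = 4 := by
  decide +kernel

/-- The permutations of `0, …, 5` that preserve the sets `{0, 1}`, `{2, 3, 4}` and `{5}`. -/
def relabelings : List (List ℕ) :=
  [0, 1].permutations'.flatMap fun a => [2, 3, 4].permutations'.map fun b => a ++ b ++ [5]

theorem relabelings_spec : ∀ l ∈ relabelings, ∀ i < 6,
    l.getD i 0 < 6 ∧ ∀ j < 6, l.getD i 0 = l.getD j 0 → i = j := by
  decide +kernel

/-- The edge sets of all relabelled members of `treePairs`. -/
def patternMasks : List ℕ :=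
  relabelings.flatMap fun l => treePairs.map fun p => edgeMask (l.getD · 0) (p.1 ++ p.2)

/-- The edges of the complete graph on `0, …, 5` that leave the vertex set with bits `a`. -/
def cutMask (a : ℕ) : ℕ :=
  edgeMask id ((List.range 6 ×ˢ List.range 6).filter fun e => a.testBit e.1 && !a.testBit e.2)

theorem search_patternMasks :
    search 15 7 patternMasks ([2 ^ 14, 2 ^ 13, 2 ^ 12] ++ (List.range 31).map (cutMask <| · + 1)) =
      true := by
  decide +kernel

theorem exists_equiv_adj_five {V : Type*} [Fintype V] (G : SimpleGraph V)
    (hcard : Fintype.card V = 6) (he : 8 ≤ G.edgeSet.ncard) :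
    ∃ e : Fin 6 ≃ V, G.Adj (e 5) (e 2) ∧ G.Adj (e 5) (e 3) ∧ G.Adj (e 5) (e 4) := by
  classical
  obtain ⟨v, hv⟩ : ∃ v, 2 < G.degree v := by
    by_contra! h
    have hsum := Finset.sum_le_card_nsmul Finset.univ (fun v => G.degree v) 2 fun v _ => h v
    rw [sum_degrees_eq_twice_card_edges, Finset.card_univ, hcard, ← Set.ncard_coe_finset,
      coe_edgeFinset] at hsum
    simp only [smul_eq_mul] at hsum
    omega
  obtain ⟨a, ha, b, hb, c, hc, hab, hac, hbc⟩ := Finset.two_lt_card.1 hv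
  rw [mem_neighborFinset] at ha hb hc
  have hrest : ({v, a, b, c} : Finset V)ᶜ.card = 2 := by
    rw [Finset.card_compl, hcard, Finset.card_eq_of_equiv_fin (n := 4)]
    exact Finset.equivFinOfCardEq (by
      simp [Finset.card_insert_of_notMem, hab, hac, hbc, ha.ne, hb.ne, hc.ne])
  obtain ⟨x, y, hxy, hxy'⟩ := Finset.card_eq_two.1 hrest
  have hx : x ∉ ({v, a, b, c} : Finset V) := by
    rw [← Finset.mem_compl, hxy']; simp
  have hy : y ∉ ({v, a, b, c} : Finset V) := by
    rw [← Finset.mem_compl, hxy']; simp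
  have hnodup : [x, y, a, b, c, v].Nodup := by
    have := ha.ne
    have := hb.ne
    have := hc.ne
    simp only [Finset.mem_insert, Finset.mem_singleton, not_or] at hx hy
    simp only [List.nodup_cons, List.mem_cons, List.not_mem_nil, List.nodup_nil]
    grind
  refine ⟨Equiv.ofBijective [x, y, a, b, c, v].get
    ((Fintype.bijective_iff_injective_and_card _).2
      ⟨List.nodup_iff_injective_get.1 hnodup, by simp [hcard]⟩), ha, hb, hc⟩

/-- The `k`-th pair of labels spans an edge of `G`. -/
def HasEdgeIndex {V : Type*} (G : SimpleGraph V) (e : Fin 6 ≃ V) (k : ℕ) : Prop :=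
  ∃ i j : Fin 6, G.Adj (e i) (e j) ∧ edgeIndex i j = k

theorem hasEdgeIndex_edgeIndex_iff {V : Type*} {G : SimpleGraph V} {e : Fin 6 ≃ V} {i j : Fin 6}
    (hij : i ≠ j) : HasEdgeIndex G e (edgeIndex i j) ↔ G.Adj (e i) (e j) := by
  refine ⟨?_, fun h => ⟨i, j, h, rfl⟩⟩
  rintro ⟨k, l, h, hkl⟩
  obtain ⟨rfl, rfl⟩ | ⟨rfl, rfl⟩ := edgeIndex_inj k l i j
    (fun hkl => h.ne (congrArg e hkl)) hij hkl
  exacts [h, h.symm]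

open Classical in
theorem count_not_hasEdgeIndex_le {V : Type*} {G : SimpleGraph V} (e : Fin 6 ≃ V)
    (he : 8 ≤ G.edgeSet.ncard) : Nat.count (fun k => ¬ HasEdgeIndex G e k) 15 ≤ 7 := by
  have hle : G.edgeSet.ncard ≤ ({k ∈ Finset.range 15 | HasEdgeIndex G e k} : Finset ℕ).card := by
    rw [← Set.ncard_coe_finset]
    refine Set.ncard_le_ncard_of_injOn
      (Sym2.lift ⟨fun x y => edgeIndex (e.symm x) (e.symm y), fun _ _ => edgeIndex_comm _ _⟩)
      ?_ ?_ (Finset.finite_toSet _)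
    · intro d
      induction d with | _ x y
      intro h
      have hne : (e.symm x : ℕ) ≠ e.symm y :=
        Fin.val_ne_of_ne (e.symm.injective.ne (G.ne_of_adj h))
      rw [Finset.mem_coe, Finset.mem_filter, Finset.mem_range]
      exact ⟨edgeIndex_lt_fifteen _ (Fin.is_lt _) _ (Fin.is_lt _) hne,
        e.symm x, e.symm y, by simpa using h, rfl⟩
    · intro d hd d' hd' h
      induction d with | _ x y
      induction d' with | _ z w
      have := edgeIndex_inj _ _ _ _ (e.symm.injective.ne (G.ne_of_adj hd))
        (e.symm.injective.ne (G.ne_of_adj hd')) h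
      simpa using this
  have := Finset.card_filter_add_card_filter_not (s := Finset.range 15) (HasEdgeIndex G e ·)
  rw [Finset.card_range] at this
  rw [Nat.count_eq_card_filter_range]
  omega

theorem exists_hasEdgeIndex_cutMask {V : Type*} {G : SimpleGraph V} (hG : G.Connected)
    (e : Fin 6 ≃ V) {a : ℕ} (ha : a < 31) :
    ∃ k < 15, (cutMask (a + 1)).testBit k ∧ HasEdgeIndex G e k := by
  have hbits : ∀ a < 31, (∃ i : Fin 6, (a + 1).testBit i) ∧ (a + 1).testBit 5 = false := by
    decide +kernel
  obtain ⟨⟨i, hi⟩, h5⟩ := hbits a ha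
  obtain ⟨p⟩ := hG.preconnected (e i) (e 5)
  obtain ⟨d, -, h1, h2⟩ := p.exists_boundary_dart {x | (a + 1).testBit (e.symm x)}
    (by simpa using hi) (by simpa using h5)
  have hne : (e.symm d.fst : ℕ) ≠ e.symm d.snd :=
    Fin.val_ne_of_ne (e.symm.injective.ne d.adj.ne)
  refine ⟨edgeIndex (e.symm d.fst) (e.symm d.snd),
    edgeIndex_lt_fifteen _ (Fin.is_lt _) _ (Fin.is_lt _) hne, ?_,
    e.symm d.fst, e.symm d.snd, by simp, rfl⟩
  rw [cutMask, testBit_edgeMask]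
  refine ⟨(e.symm d.fst, e.symm d.snd), ?_, rfl⟩
  rw [List.mem_filter]
  exact ⟨List.pair_mem_product.2
    ⟨List.mem_range.2 (Fin.is_lt _), List.mem_range.2 (Fin.is_lt _)⟩, by simp_all⟩

theorem two_le_kappaBar_of_patternMask {V : Type*} {G : SimpleGraph V} (e : Fin 6 ≃ V) {q : ℕ}
    (hq : q ∈ patternMasks) (hqe : ∀ k < 15, q.testBit k → HasEdgeIndex G e k) :
    2 ≤ G.kappaBar 4 := by
  have : Finite V := .of_equiv _ e
  simp only [patternMasks, List.mem_flatMap, List.mem_map] at hq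
  obtain ⟨l, hl, p, hp, rfl⟩ := hq
  obtain ⟨hg₁, hg₂, hlt, hverts, hdisj, hcard⟩ := treePairs_spec p hp
  have hspec := relabelings_spec l hl
  set φ : ℕ → V := fun n => e (Fin.ofNat 6 (l.getD n 0)) with hφ
  have hval {n : ℕ} (hn : n < 6) : (Fin.ofNat 6 (l.getD n 0) : ℕ) = l.getD n 0 :=
    Nat.mod_eq_of_lt (hspec n hn).1
  have hinj : {n | n < 6}.InjOn φ := by
    intro m hm n hn h
    refine (hspec m hm).2 n hn ?_
    rw [← hval hm, ← hval hn, e.injective h]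
  have hadj : ∀ d ∈ p.1 ++ p.2, G.Adj (φ d.1) (φ d.2) := by
    intro d hd
    obtain ⟨h1, h2, hne⟩ := hlt d hd
    have hne' : Fin.ofNat 6 (l.getD d.1 0) ≠ Fin.ofNat 6 (l.getD d.2 0) :=
      fun h => hne (hinj h1 h2 (congrArg e h))
    rw [hφ, ← hasEdgeIndex_edgeIndex_iff hne']
    refine hqe _ (edgeIndex_lt_fifteen _ (Fin.is_lt _) _ (Fin.is_lt _) (Fin.val_ne_of_ne hne')) ?_
    rw [testBit_edgeMask]
    exact ⟨d, hd, by rw [hval h1, hval h2]⟩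
  have hv₁ : {v | v ∈ growthVerts p.1} ⊆ {n | n < 6} := fun v hv =>
    hverts v (List.mem_append_left _ hv)
  have hv₂ : {v | v ∈ growthVerts p.2} ⊆ {n | n < 6} := fun v hv =>
    hverts v (List.mem_append_right _ hv)
  obtain ⟨T₁, hT₁, hTv₁, hTe₁⟩ := exists_isTree_of_growthVerts (hinj.mono hv₁) hg₁
    fun d hd => hadj d (List.mem_append_left _ hd)
  obtain ⟨T₂, hT₂, hTv₂, hTe₂⟩ := exists_isTree_of_growthVerts (hinj.mono hv₂) hg₂
    fun d hd => hadj d (List.mem_append_right _ hd)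
  refine two_le_kappaBar (by norm_num) hT₁ hT₂ ?_ ?_
  · rw [hTe₁, hTe₂, Set.eq_empty_iff_forall_notMem]
    rintro _ ⟨⟨c, hc, rfl⟩, d, hd, hcd⟩
    obtain ⟨hc1, hc2, -⟩ := hlt c (List.mem_append_left _ hc)
    obtain ⟨hd1, hd2, -⟩ := hlt d (List.mem_append_right _ hd)
    rcases Sym2.eq_iff.1 hcd with ⟨h1, h2⟩ | ⟨h1, h2⟩
    · exact (hdisj c hc d hd).1 ⟨hinj hc1 hd1 h1, hinj hc2 hd2 h2⟩
    · exact (hdisj c hc d hd).2 ⟨hinj hc1 hd2 h1, hinj hc2 hd1 h2⟩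
  · rw [hTv₁, hTv₂, ← hinj.image_inter hv₁ hv₂,
      (hinj.mono (Set.inter_subset_left.trans hv₁)).ncard_image, ← hcard,
      ← Set.ncard_coe_finset]
    congr 1
    ext v
    simp

/-- A connected graph with 6 vertices and at least 8 edges has `κ̄₄(G) ≥ 2`. -/
theorem stmt_10 {V : Type*} [Fintype V] (G : SimpleGraph V) (hG : G.Connected)
    (hcard : Fintype.card V = 6) (he : 8 ≤ G.edgeSet.ncard) :
    2 ≤ G.kappaBar 4 := by
  classical
  obtain ⟨e, h2, h3, h4⟩ := exists_equiv_adj_five G hcard he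
  obtain ⟨q, hq, hqe⟩ | ⟨q, hq, hqe⟩ := search_sound (HasEdgeIndex G e) 15 7 _ _
    search_patternMasks (by convert count_not_hasEdgeIndex_le e he)
  · exact two_le_kappaBar_of_patternMask e hq hqe
  · exfalso
    have hpow {k : ℕ} (hk : k < 15) (hadj : HasEdgeIndex G e k) (hqk : q = 2 ^ k) : False :=
      hqe k hk (by simp [hqk]) hadj
    simp only [List.mem_append, List.mem_cons, List.not_mem_nil, or_false, List.mem_map,
      List.mem_range] at hq
    obtain (hq | hq | hq) | ⟨a, ha, rfl⟩ := hq
    · exact hpow (k := 14) (by norm_num) ⟨5, 4, h4, rfl⟩ hq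
    · exact hpow (k := 13) (by norm_num) ⟨5, 3, h3, rfl⟩ hq
    · exact hpow (k := 12) (by norm_num) ⟨5, 2, h2, rfl⟩ hq
    · obtain ⟨k, hk, hka, hadj⟩ := exists_hasEdgeIndex_cutMask hG e ha
      exact hqe k hk hka hadj
end
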